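/- Let S = {a, a', b, b'} be a four-letter alphabet with complementation and let d ∈ {4, 5}. Every polybox code V ⊆ S^d without twin pairs having at most 10 words is rigid. -/

import Mathlib

/-- The four-letter alphabet `S = {a, a', b, b'}` is modelled as `Fin 4` with
`a = 0, a' = 1, b = 2, b' = 3`; the complementation swaps `0 ↔ 1` and `2 ↔ 3`. -/
def compl4 : Fin 4 → Fin 4 := ![1, 0, 3, 2]

/-- Two words `u, v ∈ S^d` are dichotomous if `v j = (u j)'` for some coordinate `j`. -/
def Dichotomous {S : Type*} (c : S → S) {d : ℕ} (u v : Fin d → S) : Prop :=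
  ∃ j, v j = c (u j)

/-- Two words form a twin pair if they differ by complementation at exactly one
coordinate and agree elsewhere. -/
def TwinPair {S : Type*} (c : S → S) {d : ℕ} (u v : Fin d → S) : Prop :=
  ∃ j, v j = c (u j) ∧ ∀ i, i ≠ j → u i = v i

/-- A polybox code: a set of pairwise dichotomous words. -/
def PolyboxCode {S : Type*} (c : S → S) {d : ℕ} (V : Finset (Fin d → S)) : Prop :=
  ∀ u ∈ V, ∀ v ∈ V, u ≠ v → Dichotomous c u v

/-- A code without twin pairs. -/
def TwinPairFree {S : Type*} (c : S → S) {d : ℕ} (V : Finset (Fin d → S)) : Prop :=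
  ∀ u ∈ V, ∀ v ∈ V, ¬ TwinPair c u v

/-- `ES`: the collection of all `B ⊆ S` containing exactly one letter from each
complementary pair `{s, s'}`. -/
def ESet {S : Type*} (c : S → S) : Set (Set S) :=
  {B | ∀ s : S, Xor' (s ∈ B) (c s ∈ B)}

/-- The equicomplementary realization `v̆ = Ev₁ × ⋯ × Ev_d` of a word `v`,
where `Es = {B ∈ ES : s ∈ B}`. -/
def WordBox {S : Type*} (c : S → S) {d : ℕ} (v : Fin d → S) : Set (Fin d → Set S) :=
  {x | ∀ i, x i ∈ ESet c ∧ v i ∈ x i}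

/-- `⋃ E(V)`, the union of the equicomplementary realizations of the words of `V`. -/
def CodeReal {S : Type*} (c : S → S) {d : ℕ} (V : Finset (Fin d → S)) :
    Set (Fin d → Set S) :=
  ⋃ v ∈ V, WordBox c v

/-- The word `w` is covered by the code `V`, i.e. `w̆ ⊆ ⋃ E(V)`. -/
def Covered {S : Type*} (c : S → S) {d : ℕ} (w : Fin d → S)
    (V : Finset (Fin d → S)) : Prop :=
  WordBox c w ⊆ CodeReal c V

/-- Codes `V` and `W` are equivalent: `⋃ E(V) = ⋃ E(W)`. -/
def EquivalentCodes {S : Type*} (c : S → S) {d : ℕ} (V W : Finset (Fin d → S)) : Prop :=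
  CodeReal c V = CodeReal c W

set_option linter.unusedSectionVars false

namespace PB
abbrev Wd (ι : Type) := ι → Bool × Bool
abbrev Pt (ι : Type) := ι → Bool → Bool
variable {ι : Type} [DecidableEq ι]

def In (p : Pt ι) (v : Wd ι) : Prop := ∀ k, p k (v k).1 = (v k).2
def Off (i : ι) (p : Pt ι) (v : Wd ι) : Prop := ∀ k, k ≠ i → p k (v k).1 = (v k).2
def Meets (u v : Wd ι) : Prop := ∀ k, (u k).1 = (v k).1 → (u k).2 = (v k).2
def Code (V : Finset (Wd ι)) : Prop := ∀ u ∈ V, ∀ v ∈ V, Meets u v → u = v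
def Twin (u v : Wd ι) : Prop :=
  ∃ j, (u j).1 = (v j).1 ∧ (u j).2 ≠ (v j).2 ∧ ∀ k, k ≠ j → u k = v k
def TF (V : Finset (Wd ι)) : Prop := ∀ u ∈ V, ∀ v ∈ V, ¬ Twin u v
def Cov (V : Finset (Wd ι)) (w : Wd ι) : Prop := ∀ p, In p w → ∃ v ∈ V, In p v
def Eqv (V W : Finset (Wd ι)) : Prop := ∀ p, (∃ v ∈ V, In p v) ↔ (∃ w ∈ W, In p w)
/-- set the value at coordinate i -/
def st (p : Pt ι) (i : ι) (t b c : Bool) : Pt ι :=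
  Function.update p i (fun s => if s = t then b else c)

lemma Meets.symm {u v : Wd ι} (h : Meets u v) : Meets v u := fun k hk => (h k hk.symm).symm

lemma In.meets {p : Pt ι} {u v : Wd ι} (h : In p u) (h' : In p v) : Meets u v := by
  intro k hk; rw [← h k, ← h' k, hk]

lemma Off.meets {i : ι} {p : Pt ι} {u v : Wd ι} (h : Off i p u) (h' : Off i p v)
    (hi : (u i).1 = (v i).1 → (u i).2 = (v i).2) : Meets u v := by
  intro k hk
  by_cases e : k = i
  · subst e; exact hi hk
  · rw [← h k e, ← h' k e, hk]

lemma Meets.pt {u v : Wd ι} (h : Meets u v) : ∃ p, In p u ∧ In p v := by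
  refine ⟨fun k t => if t = (u k).1 then (u k).2 else (v k).2, fun k => by simp, fun k => ?_⟩
  by_cases e : (v k).1 = (u k).1
  · simp [e, h k e.symm]
  · simp [e]

lemma In.off {p : Pt ι} {u : Wd ι} (h : In p u) (i : ι) : Off i p u := fun k _ => h k

lemma Code.eq {V : Finset (Wd ι)} (hV : Code V) {p : Pt ι} {u v : Wd ι} (hu : u ∈ V) (hv : v ∈ V)
    (h : In p u) (h' : In p v) : u = v := hV u hu v hv (h.meets h')

lemma Code.eq_off {V : Finset (Wd ι)} (hV : Code V) {i : ι} {p : Pt ι} {u v : Wd ι}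
    (hu : u ∈ V) (hv : v ∈ V) (h : Off i p u) (h' : Off i p v)
    (hi : (u i).1 = (v i).1 → (u i).2 = (v i).2) : u = v := hV u hu v hv (h.meets h' hi)

lemma Code.mono {V V' : Finset (Wd ι)} (hV : Code V) (h : V' ⊆ V) : Code V' :=
  fun u hu v hv => hV u (h hu) v (h hv)
lemma TF.mono {V V' : Finset (Wd ι)} (hV : TF V) (h : V' ⊆ V) : TF V' :=
  fun u hu v hv => hV u (h hu) v (h hv)

lemma in_st {p : Pt ι} {i : ι} {t b c : Bool} {v : Wd ι} :
    In (st p i t b c) v ↔ Off i p v ∧ (if (v i).1 = t then b else c) = (v i).2 := by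
  constructor
  · intro h
    refine ⟨fun k hk => ?_, ?_⟩
    · have := h k; simpa [st, hk] using this
    · have := h i; simpa [st] using this
  · rintro ⟨h, h'⟩ k
    by_cases e : k = i
    · subst e; simpa [st] using h'
    · simpa [st, e] using h k e

lemma off_st {p : Pt ι} {i j : ι} {t b c : Bool} {v : Wd ι} (hij : j ≠ i) :
    Off i (st p j t b c) v ↔
      (∀ k, k ≠ i → k ≠ j → p k (v k).1 = (v k).2) ∧ (if (v j).1 = t then b else c) = (v j).2 := by
  constructor
  · intro h
    refine ⟨fun k hk hk' => ?_, ?_⟩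
    · have := h k hk; simpa [st, hk'] using this
    · have := h j hij; simpa [st] using this
  · rintro ⟨h, h'⟩ k hk
    by_cases e : k = j
    · subst e; simpa [st] using h'
    · simpa [st, e] using h k hk e

/-- exchange -/
lemma exch {V : Finset (Wd ι)} (hV : Code V) {w : Wd ι} (hw : Cov V w) {i : ι} {t s : Bool}
    (hi : (w i).1 ≠ t) {p : Pt ι} (hp : Off i p w) {u : Wd ι} (hu : u ∈ V) (hui : u i = (t, s))
    (hpu : Off i p u) : ∃ c ∈ V, c i = (t, !s) ∧ Off i p c := by
  obtain ⟨c, hc, hpc⟩ := hw (st p i t (!s) (w i).2) (in_st.2 ⟨hp, by simp [hi]⟩)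
  rw [in_st] at hpc
  refine ⟨c, hc, ?_, hpc.1⟩
  by_cases e : (c i).1 = t
  · ext
    · exact e
    · simpa [e] using hpc.2.symm
  · exfalso
    have : c = u := hV.eq_off hc hu hpc.1 hpu (by simp [hui, e])
    subst this; simp [hui] at e

/-- containment inside w -/
lemma sub_lem {i : ι} {w u e : Wd ι} {p : Pt ι} (hpw : Off i p w) (hpu : Off i p u)
    (h : ∀ p, Off i p w → Off i p u → Off i p e) : ∀ k, k ≠ i → e k = w k ∨ e k = u k := by
  intro k hk
  have hpe := h p hpw hpu
  by_cases hw : (e k).1 = (w k).1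
  · left; ext; exact hw; rw [← hpe k hk, ← hpw k hk, hw]
  by_cases hu : (e k).1 = (u k).1
  · right; ext; exact hu; rw [← hpe k hk, ← hpu k hk, hu]
  exfalso
  have := h (st p k (e k).1 (!(e k).2) (p k (!(e k).1)))
    ((off_st hk).2 ⟨fun k' h1 _ => hpw k' h1, by
      rw [if_neg (Ne.symm hw), ← hpw k hk]; congr 1
      revert hw; cases (e k).1 <;> cases (w k).1 <;> simp⟩)
    ((off_st hk).2 ⟨fun k' h1 _ => hpu k' h1, by
      rw [if_neg (Ne.symm hu), ← hpu k hk]; congr 1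
      revert hu; cases (e k).1 <;> cases (u k).1 <;> simp⟩)
  have := ((off_st hk).1 this).2
  simp at this

lemma eq_lem {i : ι} {w u e : Wd ι} {p : Pt ι} (hpw : Off i p w) (hpu : Off i p u)
    (h : ∀ p, Off i p w → (Off i p u ↔ Off i p e)) : ∀ k, k ≠ i → e k = u k := by
  intro k hk
  rcases sub_lem hpw hpu (fun p h1 h2 => (h p h1).1 h2) k hk with h1 | h1
  · rcases sub_lem hpw ((h p hpw).1 hpu) (fun p h1 h2 => (h p h1).2 h2) k hk with h2 | h2
    · rw [h1, h2]
    · exact h2.symm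
  · exact h1

lemma lemT {V : Finset (Wd ι)} (hV : Code V) {w : Wd ι} (hw : Cov V w) {i : ι} {t s : Bool}
    (hi : (w i).1 ≠ t) {v0 : Wd ι} (h0 : v0 ∈ V) (h0i : v0 i = (t, s)) (h0w : Meets v0 w)
    (huniq : ∀ u ∈ V, u i = (t, s) → Meets u w → u = v0) :
    (∀ c ∈ V, c i = (t, !s) → Meets c w → ∀ k, k ≠ i → v0 k = w k ∨ v0 k = c k) ∧
    (∀ p, In p (Function.update v0 i (t, !s)) → ∃ c ∈ V, c i = (t, !s) ∧ Meets c w ∧ In p c) := by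
  have h1 : (∀ c ∈ V, c i = (t, !s) → Meets c w →
      ∀ k, k ≠ i → v0 k = w k ∨ v0 k = c k) := by
    intro c hc hci hcw
    obtain ⟨p, hp1, hp2⟩ := hcw.pt
    refine sub_lem (hp2.off i) (hp1.off i) ?_
    intro p hpw hpc
    obtain ⟨u, hu, hui, hpu⟩ := exch hV hw hi hpw hc hci hpc
    have : u = v0 := huniq u hu (by simpa using hui)
      (hpu.meets hpw (by rw [hui]; intro h; exact absurd h.symm hi))
    exact this ▸ hpu
  refine ⟨h1, fun p hp => ?_⟩
  set p' : Pt ι := fun k t => if t = (w k).1 then (w k).2 else p k t with hp'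
  have hp'w : Off i p' w := fun k hk => by simp [hp']
  have hpk : ∀ k, k ≠ i → p k (v0 k).1 = (v0 k).2 := fun k hk => by
    have := hp k; simpa [hk] using this
  have hp'0 : Off i p' v0 := fun k hk => by
    by_cases e : (v0 k).1 = (w k).1
    · simp [hp', e, h0w k e]
    · simp [hp', e, hpk k hk]
  obtain ⟨c, hc, hci, hpc⟩ := exch hV hw hi hp'w h0 h0i hp'0
  have hcw : Meets c w := hpc.meets hp'w (by rw [hci]; intro h; exact absurd h.symm hi)
  refine ⟨c, hc, hci, hcw, fun k => ?_⟩
  by_cases e : k = i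
  · subst e
    have := hp k; rw [hci]; simpa using this
  · rcases h1 c hc hci hcw k e with h2 | h2
    · have := hpc k e
      simp only [hp'] at this
      split_ifs at this with h3
      · rw [h3, ← this, ← h2]; exact hpk k e
      · exact this
    · rw [← h2]; exact hpk k e

lemma sizes0 {V : Finset (Wd ι)} (hV : Code V) (hT : TF V)
    (IH : ∀ V' ⊂ V, ∀ t ∉ V', Cov V' t → 5 ≤ V'.card)
    {w : Wd ι} (hw : Cov V w) {i : ι} {t : Bool}
    (hi : (w i).1 ≠ t) {v : Wd ι} (hv : v ∈ V) (hvi : (v i).1 = t) (hvw : Meets v w) (s : Bool) :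
    ∃ X Y : Finset (Wd ι), X ⊆ V ∧ Y ⊆ V ∧
      (∀ u, u ∈ X ↔ u ∈ V ∧ u i = (t, s) ∧ Meets u w) ∧
      (∀ u, u ∈ Y ↔ u ∈ V ∧ u i = (t, !s) ∧ Meets u w) ∧ Disjoint X Y ∧ X.Nonempty ∧ Y.Nonempty ∧
      ((2 ≤ X.card ∧ 2 ≤ Y.card) ∨ (X.card = 1 ∧ 5 ≤ Y.card) ∨ (Y.card = 1 ∧ 5 ≤ X.card)) := by
  classical
  have key : ∀ s, ∃ u ∈ V, u i = (t, s) ∧ Meets u w := by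
    intro s
    by_cases e : (v i).2 = s
    · exact ⟨v, hv, by ext <;> simp [hvi, e], hvw⟩
    · obtain ⟨p, hp1, hp2⟩ := hvw.pt
      obtain ⟨c, hc, hci, hpc⟩ := exch hV hw hi (hp2.off i) hv (s := !s)
        (by ext; exact hvi; revert e; cases (v i).2 <;> cases s <;> simp) (hp1.off i)
      exact ⟨c, hc, by simpa using hci,
        hpc.meets (hp2.off i) (by rw [hci]; intro h; exact absurd h.symm hi)⟩
  have big : ∀ s, (V.filter (fun u => u i = (t, s) ∧ Meets u w)).card = 1 →
      5 ≤ (V.filter (fun u => u i = (t, !s) ∧ Meets u w)).card := by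
    intro s h1
    obtain ⟨v0, hv0⟩ := Finset.card_eq_one.1 h1
    have m : v0 ∈ V ∧ v0 i = (t, s) ∧ Meets v0 w := by
      have : v0 ∈ V.filter (fun u => u i = (t, s) ∧ Meets u w) := by rw [hv0]; simp
      simpa using this
    have uq : ∀ u ∈ V, u i = (t, s) → Meets u w → u = v0 := by
      intro u h1 h2 h3
      have : u ∈ V.filter (fun u => u i = (t, s) ∧ Meets u w) := by simp [h1, h2, h3]
      rw [hv0] at this; simpa using this
    have T := (lemT hV hw hi m.1 m.2.1 m.2.2 uq).2
    refine IH _ ?_ (Function.update v0 i (t, !s)) ?_ ?_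
    · refine (Finset.ssubset_iff_of_subset (Finset.filter_subset _ _)).2 ⟨v0, m.1, ?_⟩
      simp [m.2.1]
    · intro hm
      refine hT v0 m.1 _ (Finset.mem_of_mem_filter _ hm) ⟨i, ?_, ?_, ?_⟩
      · simp [m.2.1]
      · simp [m.2.1]
      · intro k hk; simp [hk]
    · intro p hp
      obtain ⟨c, h1, h2, h3, h4⟩ := T p hp
      exact ⟨c, by simp [h1, h2, h3], h4⟩
  have ne : ∀ s, (V.filter (fun u => u i = (t, s) ∧ Meets u w)).Nonempty := by
    intro s; obtain ⟨u, h1, h2, h3⟩ := key s; exact ⟨u, by simp [h1, h2, h3]⟩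
  refine ⟨V.filter (fun u => u i = (t, s) ∧ Meets u w),
    V.filter (fun u => u i = (t, !s) ∧ Meets u w), Finset.filter_subset _ _,
    Finset.filter_subset _ _, by simp, by simp, ?_, ne s, ne _, ?_⟩
  · rw [Finset.disjoint_left]
    intro u h1 h2
    simp only [Finset.mem_filter] at h1 h2
    have := h1.2.1.symm.trans h2.2.1
    simp at this
  · have a := big s
    have b := big (!s)
    rw [Bool.not_not] at b
    have c := (ne s).card_pos
    have d := (ne (!s)).card_pos
    by_cases e : (V.filter (fun u => u i = (t, s) ∧ Meets u w)).card = 1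
    · exact Or.inr (Or.inl ⟨e, a e⟩)
    by_cases e' : (V.filter (fun u => u i = (t, !s) ∧ Meets u w)).card = 1
    · exact Or.inr (Or.inr ⟨e', b e'⟩)
    left; omega

lemma lemC : ∀ (n : ℕ) (V : Finset (Wd ι)), V.card = n → Code V → TF V → ∀ u ∉ V, Cov V u →
    5 ≤ V.card := by
  classical
  intro n
  induction n using Nat.strong_induction_on with
  | _ n ih =>
  intro V hn hV hT u hu hcov
  have IH : ∀ V' ⊂ V, ∀ t ∉ V', Cov V' t → 5 ≤ V'.card := fun V' h t ht hc =>
    ih V'.card (hn ▸ Finset.card_lt_card h) V' rfl (hV.mono h.1) (hT.mono h.1) t ht hc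
  by_contra hlt
  have hp : ∃ p, In p u := ⟨fun k _ => (u k).2, fun k => rfl⟩
  obtain ⟨p, hp⟩ := hp
  obtain ⟨v, hv, hpv⟩ := hcov p hp
  have hne : v ≠ u := fun h => hu (h ▸ hv)
  obtain ⟨i, hi⟩ : ∃ i, (u i).1 ≠ (v i).1 := by
    by_contra hcon
    push Not at hcon
    exact hne (funext fun k => by
      ext
      · exact (hcon k).symm
      · rw [← hpv k, ← hp k, hcon k])
  obtain ⟨X, Y, hXV, hYV, hX, hY, hd, hXn, hYn, hcase⟩ :=
    sizes0 hV hT IH hcov hi hv rfl (hpv.meets hp) true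
  have hs : X.card + Y.card ≤ V.card := by
    rw [← Finset.card_union_of_disjoint hd]
    exact Finset.card_le_card (Finset.union_subset hXV hYV)
  have h22 : X.card = 2 ∧ Y.card = 2 ∧ V.card = 4 := by omega
  have hun : X ∪ Y = V := Finset.eq_of_subset_of_card_le (Finset.union_subset hXV hYV)
    (by rw [Finset.card_union_of_disjoint hd]; omega)
  have half : ∀ s, Function.update u i ((v i).1, s) ∈ V := by
    intro s
    have hcovs : Cov (V.filter (fun x => x i = ((v i).1, s)))
        (Function.update u i ((v i).1, s)) := by
      intro q hq
      have hqo : ∀ k, k ≠ i → q k (u k).1 = (u k).2 := fun k hk => by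
        have := hq k; simpa [hk] using this
      have hqi : q i (v i).1 = s := by have := hq i; simpa using this
      obtain ⟨c, hc, hqc⟩ := hcov (st q i (v i).1 s (u i).2) (in_st.2 ⟨hqo, by simp [hi]⟩)
      have hct : (c i).1 = (v i).1 := by
        rw [← hun, Finset.mem_union] at hc
        rcases hc with hc | hc
        · rw [((hX c).1 hc).2.1]
        · rw [((hY c).1 hc).2.1]
      rw [in_st] at hqc
      have hcs : (c i).2 = s := by simpa [hct] using hqc.2.symm
      refine ⟨c, by simp only [Finset.mem_filter]; exact ⟨hc, by ext <;> simp [hct, hcs]⟩, ?_⟩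
      intro k
      by_cases e : k = i
      · subst e; rw [hct, hcs, hqi]
      · exact hqc.1 k e
    by_contra hnot
    have hss : V.filter (fun x => x i = ((v i).1, s)) ⊂ V := by
      refine (Finset.ssubset_iff_of_subset (Finset.filter_subset _ _)).2 ?_
      cases s
      · obtain ⟨x, hx⟩ := hXn
        exact ⟨x, hXV hx, by simp [((hX x).1 hx).2.1]⟩
      · obtain ⟨x, hx⟩ := hYn
        exact ⟨x, hYV hx, by simp [((hY x).1 hx).2.1]⟩
    have := IH _ hss _ (fun h => hnot (Finset.mem_of_mem_filter _ h)) hcovs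
    have := Finset.card_lt_card hss
    omega
  refine hT _ (half true) _ (half false) ⟨i, by simp, by simp, fun k hk => by simp [hk]⟩

lemma sizes {V : Finset (Wd ι)} (hV : Code V) (hT : TF V)
    {w : Wd ι} (hw : Cov V w) {i : ι} {t : Bool}
    (hi : (w i).1 ≠ t) {v : Wd ι} (hv : v ∈ V) (hvi : (v i).1 = t) (hvw : Meets v w) (s : Bool) :
    ∃ X Y : Finset (Wd ι), X ⊆ V ∧ Y ⊆ V ∧
      (∀ u, u ∈ X ↔ u ∈ V ∧ u i = (t, s) ∧ Meets u w) ∧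
      (∀ u, u ∈ Y ↔ u ∈ V ∧ u i = (t, !s) ∧ Meets u w) ∧ Disjoint X Y ∧ X.Nonempty ∧ Y.Nonempty ∧
      ((2 ≤ X.card ∧ 2 ≤ Y.card) ∨ (X.card = 1 ∧ 5 ≤ Y.card) ∨ (Y.card = 1 ∧ 5 ≤ X.card)) :=
  sizes0 hV hT (fun V' h t ht hc => lemC _ V' rfl (hV.mono h.1) (hT.mono h.1) t ht hc)
    hw hi hv hvi hvw s
end PB

namespace PB
variable {ι : Type} [DecidableEq ι]
def pu (p : Pt ι) (i : ι) (t b : Bool) : Pt ι := st p i t b (p i (!t))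

lemma in_pu_ne {p : Pt ι} {i : ι} {t b : Bool} {v : Wd ι} (h : (v i).1 ≠ t) :
    In (pu p i t b) v ↔ In p v := by
  unfold pu
  rw [in_st, if_neg h]
  have : (!t) = (v i).1 := by revert h; cases t <;> cases (v i).1 <;> simp
  rw [this]
  constructor
  · rintro ⟨h1, h2⟩ k
    by_cases e : k = i
    · subst e; exact h2
    · exact h1 k e
  · intro h; exact ⟨h.off i, h i⟩

lemma in_pu_eq {p : Pt ι} {i : ι} {t b : Bool} {v : Wd ι} (h : (v i).1 = t) :
    In (pu p i t b) v ↔ Off i p v ∧ b = (v i).2 := by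
  unfold pu
  rw [in_st, if_pos h]

lemma in_upd {p : Pt ι} {i : ι} {l : Bool × Bool} {v : Wd ι} :
    In p (Function.update v i l) ↔ Off i p v ∧ p i l.1 = l.2 := by
  constructor
  · intro h
    refine ⟨fun k hk => ?_, ?_⟩
    · have := h k; simpa [hk] using this
    · have := h i; simpa using this
  · rintro ⟨h, h'⟩ k
    by_cases e : k = i
    · subst e; simpa using h'
    · simpa [e] using h k e

lemma off_in {p : Pt ι} {i : ι} {v : Wd ι} (h : Off i p v) (h' : p i (v i).1 = (v i).2) : In p v := by
  intro k
  by_cases e : k = i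
  · subst e; exact h'
  · exact h k e

lemma twin_upd (v : Wd ι) (i : ι) (t s : Bool) (h : v i = (t, s)) :
    Twin v (Function.update v i (t, !s)) :=
  ⟨i, by simp [h], by simp [h], fun k hk => by simp [hk]⟩

section

lemma covVW {V W : Finset (Wd ι)} (hE : Eqv V W) {w : Wd ι} (hw : w ∈ W) : Cov V w :=
  fun p hp => (hE p).2 ⟨w, hw, hp⟩

lemma lemA0 {V W : Finset (Wd ι)} (hV : Code V) (hW : Code W) (hT : TF V) (hE : Eqv V W)
    (hD : ∀ v ∈ V, v ∉ W)
    (IH : ∀ V' W' : Finset (Wd ι), V'.card < V.card → V' ⊆ V → Code V' → Code W' → TF V' →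
      Eqv V' W' → V' = W') (i : ι) (hi : ∃ v ∈ V, ∃ v' ∈ V, v i ≠ v' i) :
    ∃ t, ∃ v ∈ V, ∃ w ∈ W, (v i).1 = t ∧ (w i).1 ≠ t ∧ Meets v w := by
  classical
  by_contra hcon
  push Not at hcon
  obtain ⟨v, hv, v', hv', hne⟩ := hi
  have hs : ∀ x ∈ V, ∀ y ∈ W, ∀ p, In p x → In p y → x i = y i := by
    intro x hx y hy p h1 h2
    have ht : (y i).1 = (x i).1 := by
      by_contra h
      exact hcon _ x hx y hy rfl h (h1.meets h2)
    ext
    · exact ht.symm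
    · exact h1.meets h2 i ht.symm
  have := IH (V.filter (fun x => x i = v i)) (W.filter (fun x => x i = v i))
    (Finset.card_lt_card ((Finset.ssubset_iff_of_subset (Finset.filter_subset _ _)).2
      ⟨v', hv', by simp [Ne.symm hne]⟩)) (Finset.filter_subset _ _)
    (hV.mono (Finset.filter_subset _ _)) (hW.mono (Finset.filter_subset _ _))
    (hT.mono (Finset.filter_subset _ _)) (by
      intro p
      simp only [Finset.mem_filter]
      constructor
      · rintro ⟨x, ⟨hx, hxi⟩, hp⟩
        obtain ⟨y, hy, hpy⟩ := (hE p).1 ⟨x, hx, hp⟩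
        exact ⟨y, ⟨hy, by rw [← hs x hx y hy p hp hpy, hxi]⟩, hpy⟩
      · rintro ⟨y, ⟨hy, hyi⟩, hp⟩
        obtain ⟨x, hx, hpx⟩ := (hE p).2 ⟨y, hy, hp⟩
        exact ⟨x, ⟨hx, by rw [hs x hx y hy p hpx hp, hyi]⟩, hpx⟩)
  have hm : v ∈ V.filter (fun x => x i = v i) := by simp [hv]
  rw [this] at hm
  exact hD v hv (Finset.mem_of_mem_filter _ hm)

lemma lemA1 {V W : Finset (Wd ι)} (hV : Code V) (hW : Code W) (hT : TF V) (hE : Eqv V W)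
    (hD : ∀ v ∈ V, v ∉ W) (h10 : V.card ≤ 10)
    (IH : ∀ V' W' : Finset (Wd ι), V'.card < V.card → V' ⊆ V → Code V' → Code W' → TF V' →
      Eqv V' W' → V' = W') (i : ι) (t : Bool)
    (hP : ∃ v ∈ V, ∃ w ∈ W, (v i).1 = t ∧ (w i).1 ≠ t ∧ Meets v w)
    (hN : ∀ v ∈ V, ∀ w ∈ W, (v i).1 ≠ t → (w i).1 = t → ¬ Meets v w) : False := by
  classical
  obtain ⟨v0, hv0, w0, hw0, hv0i, hw0i, hm⟩ := hP
  have hVne : ∀ s, ∃ u ∈ V, u i = (t, s) := by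
    intro s
    obtain ⟨X, Y, h1, h2, h3, h4, h5, ⟨x, hx⟩, h7, h8⟩ :=
      sizes hV hT (covVW hE hw0) hw0i hv0 hv0i hm s
    exact ⟨x, ((h3 x).1 hx).1, ((h3 x).1 hx).2.1⟩
  have hWa : ∀ s, ∀ w ∈ W, w i = (t, s) → ∀ p, In p w → ∃ u ∈ V, u i = (t, s) ∧ In p u := by
    intro s w hw hwi p hp
    obtain ⟨u, hu, hpu⟩ := (hE p).2 ⟨w, hw, hp⟩
    have : (u i).1 = t := by
      by_contra h
      exact hN u hu w hw h (by rw [hwi]) (hpu.meets hp)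
    refine ⟨u, hu, ?_, hpu⟩
    rw [← hwi]
    ext
    · rw [this, hwi]
    · exact hpu.meets hp i (by rw [this, hwi])
  have hlt : ∀ s, (V.filter (fun x => x i = (t, s))).card < V.card := by
    intro s
    obtain ⟨u, hu, hui⟩ := hVne (!s)
    exact Finset.card_lt_card ((Finset.ssubset_iff_of_subset (Finset.filter_subset _ _)).2
      ⟨u, hu, by simp [hui]⟩)
  have lt : ∀ {x : Wd ι} {s : Bool}, (x i).1 = t → (x i).2 = s → x i = (t, s) := by
    intro x s h1 h2; ext; exact h1; exact h2
  -- W^(t,s) is nonempty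
  have hWne : ∀ s, ∃ w ∈ W, w i = (t, s) := by
    intro s
    by_contra hemp
    push Not at hemp
    -- facts
    have f1 : ∀ u ∈ V, u i = (t, s) → ∀ p, Off i p u → p i t = !s →
        ∃ w ∈ W, (w i).1 ≠ t ∧ In p w := by
      intro u hu hui p hpu hpt
      have h1 : In (pu p i t s) u := (in_pu_eq (by rw [hui])).2 ⟨hpu, by rw [hui]⟩
      obtain ⟨w, hw, hpw⟩ := (hE _).1 ⟨u, hu, h1⟩
      have h2 : (w i).1 ≠ t := by
        intro h
        refine hemp w hw (lt h ?_)
        exact ((in_pu_eq h).1 hpw).2.symm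
      exact ⟨w, hw, h2, (in_pu_ne h2).1 hpw⟩
    have f2 : ∀ u ∈ V, u i = (t, s) → ∀ p, Off i p u → p i t = !s →
        ∃ x ∈ V, x i = (t, !s) ∧ In p x := by
      intro u hu hui p hpu hpt
      obtain ⟨w, hw, hwi, hpw⟩ := f1 u hu hui p hpu hpt
      obtain ⟨c, hc, hci, hpc⟩ := exch hV (covVW hE hw) hwi (hpw.off i) hu hui hpu
      exact ⟨c, hc, hci, off_in hpc (by rw [hci]; exact hpt)⟩
    have := IH (V.filter (fun x => x i = (t, !s)))
      ((V.filter (fun x => x i = (t, s))).image (fun x => Function.update x i (t, !s)) ∪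
        W.filter (fun x => x i = (t, !s))) (hlt _) (Finset.filter_subset _ _)
      (hV.mono (Finset.filter_subset _ _)) ?_ (hT.mono (Finset.filter_subset _ _)) ?_
    · obtain ⟨u, hu, hui⟩ := hVne s
      have hmem : Function.update u i (t, !s) ∈ V.filter (fun x => x i = (t, !s)) := by
        rw [this]
        refine Finset.mem_union_left _ (Finset.mem_image.2 ⟨u, by simp [hu, hui], rfl⟩)
      exact hT u hu _ (Finset.mem_of_mem_filter _ hmem) (twin_upd u i t s hui)
    · have cross : ∀ u ∈ V, u i = (t, s) → ∀ w ∈ W, w i = (t, !s) →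
          ¬ Meets (Function.update u i (t, !s)) w := by
        intro u hu hui w hw hwi hmm
        obtain ⟨p, h1, h2⟩ := hmm.pt
        rw [in_upd] at h1
        obtain ⟨w2, hw2, hw2i, hpw2⟩ := f1 u hu hui p h1.1 h1.2
        have := hW.eq hw hw2 h2 hpw2
        subst this
        exact hw2i (by rw [hwi])
      intro a ha b hb hab
      simp only [Finset.mem_union, Finset.mem_image, Finset.mem_filter] at ha hb
      rcases ha with ⟨a', ⟨ha1, ha2⟩, rfl⟩ | ⟨ha1, ha2⟩ <;>
        rcases hb with ⟨b', ⟨hb1, hb2⟩, rfl⟩ | ⟨hb1, hb2⟩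
      · obtain ⟨p, h1, h2⟩ := hab.pt
        rw [in_upd] at h1 h2
        rw [hV.eq_off ha1 hb1 h1.1 h2.1 (by simp [ha2, hb2])]
      · exact absurd hab (cross _ ha1 ha2 _ hb1 hb2)
      · exact absurd hab.symm (cross _ hb1 hb2 _ ha1 ha2)
      · exact hW _ ha1 _ hb1 hab
    · intro p
      constructor
      · rintro ⟨x, hx, hp⟩
        simp only [Finset.mem_filter] at hx
        obtain ⟨w, hw, hpw⟩ := (hE p).1 ⟨x, hx.1, hp⟩
        by_cases hwi : (w i).1 = t
        · refine ⟨w, Finset.mem_union_right _ ?_, hpw⟩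
          simp only [Finset.mem_filter]
          refine ⟨hw, lt hwi ?_⟩
          have := hpw.meets hp i (by rw [hwi, hx.2])
          rw [this, hx.2]
        · obtain ⟨c, hc, hci, hpc⟩ := exch hV (covVW hE hw) hwi (hpw.off i) hx.1 hx.2 (hp.off i)
          rw [Bool.not_not] at hci
          refine ⟨Function.update c i (t, !s), Finset.mem_union_left _
            (Finset.mem_image.2 ⟨c, by simp [hc, hci], rfl⟩), in_upd.2 ⟨hpc, ?_⟩⟩
          have := hp i
          rw [hx.2] at this; exact this
      · rintro ⟨x, hx, hp⟩
        simp only [Finset.mem_union, Finset.mem_image, Finset.mem_filter] at hx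
        rcases hx with ⟨u, ⟨hu, hui⟩, rfl⟩ | ⟨hx, hxi⟩
        · rw [in_upd] at hp
          obtain ⟨y, h1, h2, h3⟩ := f2 u hu hui p hp.1 hp.2
          exact ⟨y, by simp [h1, h2], h3⟩
        · obtain ⟨y, h1, h2, h3⟩ := hWa _ x hx hxi p hp
          exact ⟨y, by simp [h1, h2], h3⟩
  have h5 : ∀ s, 5 ≤ (V.filter (fun x => x i = (t, s))).card := by
    intro s
    obtain ⟨w, hw, hwi⟩ := hWne s
    refine lemC _ _ rfl (hV.mono (Finset.filter_subset _ _)) (hT.mono (Finset.filter_subset _ _))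
      w (fun h => hD w (Finset.mem_of_mem_filter _ h) hw) ?_
    intro p hp
    obtain ⟨y, h1, h2, h3⟩ := hWa _ w hw hwi p hp
    exact ⟨y, by simp [h1, h2], h3⟩
  have hall : ∀ v ∈ V, (v i).1 = t := by
    have hd : Disjoint (V.filter (fun x => x i = (t, true))) (V.filter (fun x => x i = (t, false))) := by
      rw [Finset.disjoint_left]
      intro u h1 h2
      simp only [Finset.mem_filter] at h1 h2
      have := h1.2.symm.trans h2.2
      simp at this
    have hun := Finset.eq_of_subset_of_card_le
      (Finset.union_subset (Finset.filter_subset (fun x => x i = (t, true)) V)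
        (Finset.filter_subset (fun x => x i = (t, false)) V))
      (by rw [Finset.card_union_of_disjoint hd]; have := h5 true; have := h5 false; omega)
    intro v hv
    rw [← hun] at hv
    simp only [Finset.mem_union, Finset.mem_filter] at hv
    rcases hv with h | h <;> rw [h.2]
  have fin : ∀ s, Function.update w0 i (t, s) ∈ V := by
    intro s
    have := IH (V.filter (fun x => x i = (t, s)))
      ((W.filter (fun x => x i = w0 i)).image (fun x => Function.update x i (t, s)) ∪
        W.filter (fun x => x i = (t, s))) (hlt _) (Finset.filter_subset _ _)
      (hV.mono (Finset.filter_subset _ _)) ?_ (hT.mono (Finset.filter_subset _ _)) ?_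
    · have hmem : Function.update w0 i (t, s) ∈ V.filter (fun x => x i = (t, s)) := by
        rw [this]
        refine Finset.mem_union_left _ (Finset.mem_image.2 ⟨w0, by simp [hw0], rfl⟩)
      exact Finset.mem_of_mem_filter _ hmem
    · have cross : ∀ u ∈ W, u i = w0 i → ∀ w ∈ W, w i = (t, s) →
          ¬ Meets (Function.update u i (t, s)) w := by
        intro u hu hui w hw hwi hmm
        obtain ⟨p, h1, h2⟩ := hmm.pt
        rw [in_upd] at h1
        have := hW.eq_off hu hw h1.1 (h2.off i) (by rw [hui, hwi]; intro h; exact absurd h hw0i)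
        subst this
        exact hw0i (by rw [← hui, hwi])
      intro a ha b hb hab
      simp only [Finset.mem_union, Finset.mem_image, Finset.mem_filter] at ha hb
      rcases ha with ⟨a', ⟨ha1, ha2⟩, rfl⟩ | ⟨ha1, ha2⟩ <;>
        rcases hb with ⟨b', ⟨hb1, hb2⟩, rfl⟩ | ⟨hb1, hb2⟩
      · obtain ⟨p, h1, h2⟩ := hab.pt
        rw [in_upd] at h1 h2
        rw [hW.eq_off ha1 hb1 h1.1 h2.1 (by simp [ha2, hb2])]
      · exact absurd hab (cross _ ha1 ha2 _ hb1 hb2)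
      · exact absurd hab.symm (cross _ hb1 hb2 _ ha1 ha2)
      · exact hW _ ha1 _ hb1 hab
    · intro p
      constructor
      · rintro ⟨x, hx, hp⟩
        simp only [Finset.mem_filter] at hx
        have hpt : p i t = s := by have := hp i; rw [hx.2] at this; exact this
        have h1 : In (st p i t s (w0 i).2) x := in_st.2 ⟨hp.off i, by simp [hx.2]⟩
        obtain ⟨w, hw, hpw⟩ := (hE _).1 ⟨x, hx.1, h1⟩
        rw [in_st] at hpw
        by_cases hwi : (w i).1 = t
        · have h2 : (w i).2 = s := by simpa [hwi] using hpw.2.symm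
          refine ⟨w, Finset.mem_union_right _ ?_, off_in hpw.1 (by rw [hwi, h2, hpt])⟩
          simp only [Finset.mem_filter]
          exact ⟨hw, lt hwi h2⟩
        · have h2 : (w i).2 = (w0 i).2 := by simpa [hwi] using hpw.2.symm
          have h3 : (w i).1 = (w0 i).1 := by
            revert hwi hw0i; cases t <;> cases (w i).1 <;> cases (w0 i).1 <;> simp
          refine ⟨Function.update w i (t, s), Finset.mem_union_left _
            (Finset.mem_image.2 ⟨w, ?_, rfl⟩), in_upd.2 ⟨hpw.1, hpt⟩⟩
          simp only [Finset.mem_filter]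
          exact ⟨hw, Prod.ext h3 h2⟩
      · rintro ⟨x, hx, hp⟩
        simp only [Finset.mem_union, Finset.mem_image, Finset.mem_filter] at hx
        rcases hx with ⟨u, ⟨hu, hui⟩, rfl⟩ | ⟨hx, hxi⟩
        · rw [in_upd] at hp
          have h1 : In (st p i t s (w0 i).2) u := in_st.2 ⟨hp.1, by simp [hui, hw0i]⟩
          obtain ⟨x, hx, hpx⟩ := (hE _).2 ⟨u, hu, h1⟩
          rw [in_st] at hpx
          have h2 : (x i).2 = s := by simpa [hall x hx] using hpx.2.symm
          refine ⟨x, ?_, off_in hpx.1 (by rw [hall x hx, h2]; exact hp.2)⟩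
          simp only [Finset.mem_filter]
          exact ⟨hx, lt (hall x hx) h2⟩
        · obtain ⟨y, h1, h2, h3⟩ := hWa _ x hx hxi p hp
          exact ⟨y, by simp [h1, h2], h3⟩
  exact hT _ (fin true) _ (fin false) ⟨i, by simp, by simp, fun k hk => by simp [hk]⟩

lemma lemA {V W : Finset (Wd ι)} (hV : Code V) (hW : Code W) (hT : TF V) (hE : Eqv V W)
    (hD : ∀ v ∈ V, v ∉ W) (h10 : V.card ≤ 10)
    (IH : ∀ V' W' : Finset (Wd ι), V'.card < V.card → V' ⊆ V → Code V' → Code W' → TF V' →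
      Eqv V' W' → V' = W') (i : ι) (hi : ∃ v ∈ V, ∃ v' ∈ V, v i ≠ v' i) (t : Bool) :
    ∃ v ∈ V, ∃ w ∈ W, (v i).1 = t ∧ (w i).1 ≠ t ∧ Meets v w := by
  obtain ⟨t0, h0⟩ := lemA0 hV hW hT hE hD IH i hi
  by_cases e : t = t0
  · subst e; exact h0
  by_contra hcon
  push Not at hcon
  refine lemA1 hV hW hT hE hD h10 IH i t0 h0 ?_
  intro v hv w hw h1 h2
  exact hcon v hv w hw (by revert e h1; cases t <;> cases t0 <;> cases (v i).1 <;> simp)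
    (by rw [h2]; exact Ne.symm e)
end
end PB

namespace PB
variable {ι : Type} [DecidableEq ι]

lemma off_pu_ne {p : Pt ι} {i j : ι} {t b : Bool} {v : Wd ι} (h : (v j).1 ≠ t) :
    Off i (pu p j t b) v ↔ Off i p v := by
  have : ∀ k, pu p j t b k (v k).1 = p k (v k).1 := by
    intro k
    by_cases e : k = j
    · subst e
      have : (!t) = (v k).1 := by revert h; cases t <;> cases (v k).1 <;> simp
      simp [pu, st, h, this]
    · simp [pu, st, e]
  simp [Off, this]

lemma pu_same (p : Pt ι) (j : ι) (t b : Bool) : pu p j t b j t = b := by simp [pu, st]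
lemma pu_other (p : Pt ι) (j : ι) (t b : Bool) : pu p j t b j (!t) = p j (!t) := by simp [pu, st]
lemma pu_ne (p : Pt ι) {j k : ι} (t b : Bool) (h : k ≠ j) : pu p j t b k = p k := by
  simp [pu, st, h]

lemma off_split {p : Pt ι} {i j : ι} {v : Wd ι} (hij : j ≠ i) : Off i p v ↔
    (∀ k, k ≠ i → k ≠ j → p k (v k).1 = (v k).2) ∧ p j (v j).1 = (v j).2 := by
  constructor
  · intro h; exact ⟨fun k h1 _ => h k h1, h j hij⟩
  · rintro ⟨h1, h2⟩ k hk
    by_cases e : k = j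
    · subst e; exact h2
    · exact h1 k hk e

lemma off_upd {p : Pt ι} {i j : ι} {v : Wd ι} {l : Bool × Bool} (hij : j ≠ i) :
    Off i p (Function.update v j l) ↔
    (∀ k, k ≠ i → k ≠ j → p k (v k).1 = (v k).2) ∧ p j l.1 = l.2 := by
  rw [off_split hij]
  simp only [Function.update_self]
  constructor
  · rintro ⟨h1, h2⟩
    exact ⟨fun k hk hk' => by simpa [hk'] using h1 k hk hk', h2⟩
  · rintro ⟨h1, h2⟩
    exact ⟨fun k hk hk' => by simpa [hk'] using h1 k hk hk', h2⟩

lemma two_lem {i k : ι} (hk : k ≠ i) {w A B C : Wd ι} (hA : ∃ p, Off i p w ∧ Off i p A)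
    (hB : ∃ p, Off i p w ∧ Off i p B)
    (hk1 : (A k).1 = (B k).1) (hk2 : (A k).2 ≠ (B k).2)
    (h : ∀ p, Off i p w → (Off i p C ↔ Off i p A ∨ Off i p B)) :
    C k = w k ∧ ∀ k', k' ≠ i → k' ≠ k → A k' = C k' ∧ B k' = C k' := by
  obtain ⟨pA, hpA, hpA'⟩ := hA
  obtain ⟨pB, hpB, hpB'⟩ := hB
  have sA := sub_lem hpA hpA' (fun p h1 h2 => (h p h1).2 (Or.inl h2))
  have sB := sub_lem hpB hpB' (fun p h1 h2 => (h p h1).2 (Or.inr h2))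
  have hwk : (w k).1 ≠ (A k).1 := by
    intro e
    have h1 := hpA k hk
    have h2 := hpA' k hk
    have h3 := hpB k hk
    have h4 := hpB' k hk
    rw [e] at h1 h3
    rw [← hk1] at h4
    rw [h1] at h2; rw [h3] at h4
    exact hk2 (h2.symm.trans h4)
  have hC : C k = w k := by
    rcases sA k hk with h1 | h1
    · exact h1
    · rcases sB k hk with h2 | h2
      · exact h2
      · exact absurd (by rw [← h1, ← h2]) hk2
  refine ⟨hC, ?_⟩
  -- generic argument
  have gen : ∀ A B : Wd ι, (∀ k, k ≠ i → C k = w k ∨ C k = A k) → ∀ p, Off i p w → Off i p A →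
      (A k).1 = (B k).1 → (A k).2 ≠ (B k).2 → (w k).1 ≠ (A k).1 →
      (∀ p, Off i p w → (Off i p C ↔ Off i p A ∨ Off i p B)) →
      ∀ k', k' ≠ i → k' ≠ k → A k' = C k' := by
    intro A B sA p hpw hpA hk1 hk2 hwk h k' hk' hkk
    by_contra hne
    have hCw : C k' = w k' := by
      rcases sA k' hk' with h1 | h1
      · exact h1
      · exact absurd h1.symm hne
    have hpC : Off i p C := (h p hpw).2 (Or.inl hpA)
    have hty : (w k').1 ≠ (A k').1 := by
      intro e
      apply hne
      rw [hCw]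
      ext
      · exact e.symm
      · rw [← hpA k' hk', ← hpw k' hk', e]
    set q := pu p k' (A k').1 (!(A k').2) with hq
    have hqw : Off i q w := (off_pu_ne hty).2 hpw
    have hqC : Off i q C := (off_pu_ne (by rw [hCw]; exact hty)).2 hpC
    rcases (h q hqw).1 hqC with h1 | h1
    · have := h1 k' hk'
      rw [hq, pu_same] at this
      simp at this
    · have := h1 k hk
      rw [hq, pu_ne _ _ _ (Ne.symm hkk), ← hk1, hpA k hk] at this
      exact hk2 this
  intro k' h1 h2
  refine ⟨gen A B sA pA hpA hpA' hk1 hk2 hwk h k' h1 h2,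
    gen B A sB pB hpB hpB' hk1.symm hk2.symm (hk1 ▸ hwk) (fun p hp => ?_) k' h1 h2⟩
  rw [h p hp, or_comm]

lemma bne {a b : Bool} (h : a ≠ b) : a = !b := by revert h; cases a <;> cases b <;> simp

lemma G2 {V : Finset (Wd ι)} (hV : Code V) {w : Wd ι} (hw : Cov V w) {i j : ι} (hij : j ≠ i)
    {t s tj su : Bool} (hwi : (w i).1 ≠ t) (hwj : (w j).1 ≠ tj) {u : Wd ι}
    (hu : u ∈ V) (hui : u i = (t, s)) (huj : u j = (tj, su))
    (hX : ∀ x ∈ V, x i = (t, s) → x = u ∨ x j = (tj, !su))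
    (hY : ∀ d ∈ V, d i = (t, !s) → Meets d w → d j = w j ∨ d j = (tj, !su))
    (p : Pt ι) (hp : Off i p w) :
    Off i p (Function.update u j (w j)) ↔ ∃ d ∈ V, d i = (t, !s) ∧ d j = w j ∧ Off i p d := by
  have hp1 : Off i (pu p j tj su) w := (off_pu_ne hwj).2 hp
  constructor
  · intro h
    rw [off_upd hij] at h
    have h1 : Off i (pu p j tj su) u := by
      rw [off_split hij]
      refine ⟨fun k h1 h2 => ?_, by rw [huj, pu_same]⟩
      rw [pu_ne _ _ _ h2]; exact h.1 k h1 h2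
    obtain ⟨d, hd, hdi, hpd⟩ := exch hV hw hwi hp1 hu hui h1
    have hdw : Meets d w := hpd.meets hp1 (by rw [hdi]; intro h; exact absurd h.symm hwi)
    rcases hY d hd hdi hdw with h2 | h2
    · exact ⟨d, hd, hdi, h2, (off_pu_ne (by rw [h2]; exact hwj)).1 hpd⟩
    · have := hpd j hij
      rw [h2, pu_same] at this
      simp at this
  · rintro ⟨d, hd, hdi, hdj, hpd⟩
    have hpd1 : Off i (pu p j tj su) d := (off_pu_ne (by rw [hdj]; exact hwj)).2 hpd
    obtain ⟨x, hx, hxi, hpx⟩ := exch hV hw hwi hp1 hd hdi hpd1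
    rw [Bool.not_not] at hxi
    rcases hX x hx hxi with rfl | h2
    · rw [off_upd hij]
      refine ⟨fun k h1 h2 => ?_, hp j hij⟩
      have := hpx k h1
      rwa [pu_ne _ _ _ h2] at this
    · have := hpx j hij
      rw [h2, pu_same] at this
      simp at this

lemma G1 {V : Finset (Wd ι)} (hV : Code V) {w : Wd ι} (hw : Cov V w) {i j : ι} (hij : j ≠ i)
    {t s tj su : Bool} (hwi : (w i).1 ≠ t) (hwj : (w j).1 ≠ tj) {u c : Wd ι}
    (hu : u ∈ V) (hui : u i = (t, s)) (huj : u j = (tj, su))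
    (hX : ∀ x ∈ V, x i = (t, s) → x = u ∨ x j = (tj, !su))
    (hc : c ∈ V) (hci : c i = (t, !s)) (hcw : Meets c w) (hcj : c j = w j)
    (hY : ∀ d ∈ V, d i = (t, !s) → Meets d w → d = c ∨ d j = (tj, !su)) :
    ∀ k, k ≠ i → k ≠ j → c k = u k := by
  have hY' : ∀ d ∈ V, d i = (t, !s) → Meets d w → d j = w j ∨ d j = (tj, !su) := by
    intro d hd hdi hdw
    rcases hY d hd hdi hdw with rfl | h
    · exact Or.inl hcj
    · exact Or.inr h
  obtain ⟨p, hp1, hp2⟩ := hcw.pt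
  have := eq_lem (i := i) (w := w) (u := c) (e := Function.update u j (w j)) (hp2.off i) (hp1.off i) ?_
  · intro k hk hkj
    have := this k hk
    simpa [hkj] using this.symm
  · intro p hp
    rw [G2 hV hw hij hwi hwj hu hui huj hX hY' p hp]
    constructor
    · intro h; exact ⟨c, hc, hci, hcj, h⟩
    · rintro ⟨d, hd, hdi, hdj, hpd⟩
      have hdw : Meets d w := hpd.meets hp (by rw [hdi]; intro h; exact absurd h.symm hwi)
      rcases hY d hd hdi hdw with rfl | h
      · exact hpd
      · rw [hdj] at h
        exact absurd (by rw [h]) hwj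

lemma step1 {V : Finset (Wd ι)} (hV : Code V) (hT : TF V) {w : Wd ι} (hw : Cov V w) {i j : ι}
    (hij : j ≠ i) {t s tj sj : Bool} (hwi : (w i).1 ≠ t) {u1 u2 : Wd ι}
    (hu1 : u1 ∈ V) (hu2 : u2 ∈ V) (hu1i : u1 i = (t, s)) (hu2i : u2 i = (t, s))
    (hu1j : u1 j = (tj, sj)) (hu2j : u2 j = (tj, !sj))
    (hX : ∀ x ∈ V, x i = (t, s) → x = u1 ∨ x = u2) (m1 : Meets u1 w) (m2 : Meets u2 w)
    (hY3 : (V.filter (fun x => x i = (t, !s))).card ≤ 3) :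
    (w j).1 ≠ tj ∧ ∃ c ∈ V, c i = (t, !s) ∧ Meets c w ∧ c j = w j := by
  classical
  have hwj : (w j).1 ≠ tj := by
    intro h
    have h1 := m1 j (by rw [hu1j, h])
    have h2 := m2 j (by rw [hu2j, h])
    rw [hu1j] at h1; rw [hu2j] at h2
    rw [← h1] at h2
    simp at h2
  refine ⟨hwj, ?_⟩
  by_contra hcon
  push Not at hcon
  have hty : ∀ d ∈ V, d i = (t, !s) → Meets d w → (d j).1 = tj := by
    intro d hd hdi hdw
    by_contra h
    have h1 : (d j).1 = (w j).1 := by rw [bne h, bne hwj]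
    exact hcon d hd hdi hdw (Prod.ext h1 (hdw j h1))
  -- contradiction from a side with at most one element
  have main : ∀ u ∈ V, u i = (t, s) → Meets u w → ∀ b, u j = (tj, b) →
      (∀ x ∈ V, x i = (t, s) → x j = (tj, b) → x = u) →
      (∀ d ∈ V, d i = (t, !s) → d j = (tj, b) → ∀ d' ∈ V, d' i = (t, !s) → d' j = (tj, b) → d = d') →
      (∀ x ∈ V, x i = (t, s) → (x j).1 = tj) → False := by
    intro u hu hui huw b huj hux huq hxt
    obtain ⟨p, hp1, hp2⟩ := huw.pt
    have get : ∀ p, Off i p w → Off i p u → ∃ d ∈ V, d i = (t, !s) ∧ d j = (tj, b) ∧ Off i p d := by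
      intro p hpw hpu
      obtain ⟨d, hd, hdi, hpd⟩ := exch hV hw hwi hpw hu hui hpu
      have hdw : Meets d w := hpd.meets hpw (by rw [hdi]; intro h; exact absurd h.symm hwi)
      have h1 := hty d hd hdi hdw
      refine ⟨d, hd, hdi, Prod.ext h1 ?_, hpd⟩
      have h2 := hpd j hij
      have h3 := hpu j hij
      rw [huj] at h3
      rw [h1] at h2
      exact h2.symm.trans h3
    obtain ⟨e, he, hei, hej, hpe⟩ := get p (hp2.off i) (hp1.off i)
    have heq := eq_lem (i := i) (w := w) (u := u) (e := e) (hp2.off i) (hp1.off i) (by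
      intro p hpw
      constructor
      · intro hpu
        obtain ⟨d, hd, hdi, hdj, hpd⟩ := get p hpw hpu
        rw [huq e he hei hej d hd hdi hdj]; exact hpd
      · intro hpe
        obtain ⟨x, hx, hxi, hpx⟩ := exch hV hw hwi hpw he hei hpe
        rw [Bool.not_not] at hxi
        have h1 := hxt x hx hxi
        have h2 := hpx j hij
        have h3 := hpe j hij
        rw [h1] at h2; rw [hej] at h3
        rw [← hux x hx hxi (Prod.ext h1 (h2.symm.trans h3))]
        exact hpx)
    exact hT u hu e he ⟨i, by rw [hui, hei], by rw [hui, hei]; simp, fun k hk => (heq k hk).symm⟩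
  have hxt : ∀ x ∈ V, x i = (t, s) → (x j).1 = tj := by
    intro x hx hxi
    rcases hX x hx hxi with rfl | rfl
    · rw [hu1j]
    · rw [hu2j]
  have c1 := fun h => main u1 hu1 hu1i m1 sj hu1j (by
    intro x hx hxi hxj
    rcases hX x hx hxi with rfl | rfl
    · rfl
    · rw [hu2j] at hxj; simp at hxj) h hxt
  have c2 := fun h => main u2 hu2 hu2i m2 (!sj) hu2j (by
    intro x hx hxi hxj
    rcases hX x hx hxi with rfl | rfl
    · rw [hu1j] at hxj; simp at hxj
    · rfl) h hxt
  simp only [imp_false] at c1 c2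
  push Not at c1 c2
  obtain ⟨a, ha, hai, haj, a', ha', hai', haj', hne⟩ := c1
  obtain ⟨b, hb, hbi, hbj, b', hb', hbi', hbj', hne'⟩ := c2
  have d1 : ∀ x y : Wd ι, x j = (tj, sj) → y j = (tj, !sj) → x ≠ y := by
    intro x y h1 h2 h3
    subst h3; rw [h1] at h2; simp at h2
  have : ({a, a', b, b'} : Finset (Wd ι)).card = 4 := by
    rw [Finset.card_insert_of_notMem, Finset.card_insert_of_notMem, Finset.card_pair hne']
    · simp [d1 a' b haj' hbj, d1 a' b' haj' hbj']
    · simp [hne, d1 a b haj hbj, d1 a b' haj hbj']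
  have hs : ({a, a', b, b'} : Finset (Wd ι)) ⊆ V.filter (fun x => x i = (t, !s)) := by
    intro x hx
    simp only [Finset.mem_insert, Finset.mem_singleton] at hx
    simp only [Finset.mem_filter]
    rcases hx with rfl | rfl | rfl | rfl <;> exact ⟨by assumption, by assumption⟩
  have := Finset.card_le_card hs
  omega
end PB

namespace PB
variable {ι : Type} [DecidableEq ι]

def nn (V : Finset (Wd ι)) (i : ι) (t : Bool) : ℕ := (V.filter (fun v => (v i).1 = t)).card
def nl (V : Finset (Wd ι)) (i : ι) (t s : Bool) : ℕ := (V.filter (fun v => v i = (t, s))).card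

lemma nn_split (V : Finset (Wd ι)) (i : ι) (t s : Bool) : nn V i t = nl V i t s + nl V i t (!s) := by
  classical
  unfold nn nl
  rw [← Finset.card_union_of_disjoint]
  · congr 1
    ext x
    simp only [Finset.mem_filter, Finset.mem_union, Prod.ext_iff]
    cases (x i).2 <;> cases s <;> simp
  · rw [Finset.disjoint_left]
    intro x h1 h2
    simp only [Finset.mem_filter] at h1 h2
    rw [h1.2] at h2
    simp at h2

lemma nn_total (V : Finset (Wd ι)) (i : ι) (t : Bool) : nn V i t + nn V i (!t) = V.card := by
  unfold nn
  rw [← Finset.card_filter_add_card_filter_not (s := V) (fun v => (v i).1 = t)]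
  congr 2
  ext x
  simp only [Finset.mem_filter]
  cases (x i).1 <;> cases t <;> simp

lemma sizes' {V : Finset (Wd ι)} (hV : Code V) (hT : TF V)
    {w : Wd ι} (hw : Cov V w) {i : ι} {t : Bool}
    (hi : (w i).1 ≠ t) {v : Wd ι} (hv : v ∈ V) (hvi : (v i).1 = t) (hvw : Meets v w) (s : Bool) :
    ∃ X Y : Finset (Wd ι), 
      (∀ u, u ∈ X ↔ u ∈ V ∧ u i = (t, s) ∧ Meets u w) ∧
      (∀ u, u ∈ Y ↔ u ∈ V ∧ u i = (t, !s) ∧ Meets u w) ∧ X ⊆ V.filter (fun v => v i = (t, s)) ∧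
      Y ⊆ V.filter (fun v => v i = (t, !s)) ∧ X.card ≤ nl V i t s ∧ Y.card ≤ nl V i t (!s) ∧ 
      ((2 ≤ X.card ∧ 2 ≤ Y.card) ∨ (X.card = 1 ∧ 5 ≤ Y.card) ∨ (Y.card = 1 ∧ 5 ≤ X.card)) := by
  obtain ⟨X, Y, -, -, hX, hY, -, -, -, h⟩ := sizes hV hT hw hi hv hvi hvw s
  have h1 : X ⊆ V.filter (fun v => v i = (t, s)) := by
    intro x hx; rw [hX] at hx; simp [hx]
  have h2 : Y ⊆ V.filter (fun v => v i = (t, !s)) := by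
    intro x hx; rw [hY] at hx; simp [hx]
  exact ⟨X, Y, hX, hY, h1, h2, Finset.card_le_card h1, Finset.card_le_card h2, h⟩

lemma ge4 {V : Finset (Wd ι)} (hV : Code V) (hT : TF V) {i : ι} {t : Bool}
    (hex : ∃ v ∈ V, ∃ w, Cov V w ∧ (v i).1 = t ∧ (w i).1 ≠ t ∧ Meets v w) :
    4 ≤ nn V i t ∧ ∀ s, 1 ≤ nl V i t s := by
  obtain ⟨v, hv, w, hw, hvi, hwi, hm⟩ := hex
  obtain ⟨X, Y, -, -, -, -, h1, h2, h3⟩ := sizes' hV hT hw hwi hv hvi hm true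
  have := nn_split V i t true
  refine ⟨by omega, ?_⟩
  intro s
  cases s
  · simp only [Bool.not_true] at h2; omega
  · omega

lemma light {V : Finset (Wd ι)} (hV : Code V) (hT : TF V) {i : ι} {t : Bool} (h5 : nn V i t ≤ 5)
    (hex : ∃ v ∈ V, ∃ w, Cov V w ∧ (v i).1 = t ∧ (w i).1 ≠ t ∧ Meets v w) :
    ∃ s, ∃ u1 ∈ V, ∃ u2 ∈ V, u1 ≠ u2 ∧ u1 i = (t, s) ∧ u2 i = (t, s) ∧
      (∀ x ∈ V, x i = (t, s) → x = u1 ∨ x = u2) ∧ nn V i t = 2 + nl V i t (!s) ∧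
      nl V i t (!s) ≤ 3 ∧
      (∀ w, Cov V w → (w i).1 ≠ t → ∀ v ∈ V, (v i).1 = t → Meets v w → Meets u1 w ∧ Meets u2 w ∧
        ∃ a ∈ V, ∃ b ∈ V, a ≠ b ∧ a i = (t, !s) ∧ b i = (t, !s) ∧ Meets a w ∧ Meets b w) := by
  classical
  obtain ⟨s, hs⟩ : ∃ s, nl V i t s ≤ nl V i t (!s) := by
    rcases le_total (nl V i t true) (nl V i t false) with h | h
    · exact ⟨true, h⟩
    · exact ⟨false, h⟩
  have hsp := nn_split V i t s
  have h2 : nl V i t s = 2 := by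
    obtain ⟨v, hv, w, hw, hvi, hwi, hm⟩ := hex
    obtain ⟨X, Y, -, -, -, -, h1, h2, h3⟩ := sizes' hV hT hw hwi hv hvi hm s
    omega
  obtain ⟨u1, u2, hne, hu⟩ := Finset.card_eq_two.1 h2
  have hm : ∀ x, (x ∈ V ∧ x i = (t, s)) ↔ x = u1 ∨ x = u2 := by
    intro x
    have : x ∈ V.filter (fun v => v i = (t, s)) ↔ x = u1 ∨ x = u2 := by rw [hu]; simp
    simpa using this
  have m1 := (hm u1).2 (Or.inl rfl)
  have m2 := (hm u2).2 (Or.inr rfl)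
  refine ⟨s, u1, m1.1, u2, m2.1, hne, m1.2, m2.2, fun x h1 h2 => (hm x).1 ⟨h1, h2⟩, by omega, by omega, ?_⟩
  intro w hw hwi v hv hvi hvw
  obtain ⟨X, Y, hX, hY, hXs, hYs, h1, h2', h3⟩ := sizes' hV hT hw hwi hv hvi hvw s
  have hX2 : X.card = 2 := by omega
  have hXe : X = V.filter (fun v => v i = (t, s)) := Finset.eq_of_subset_of_card_le hXs (by
    rw [hX2]; exact h2.le)
  have k1 : u1 ∈ X := by rw [hXe]; simp [m1]
  have k2 : u2 ∈ X := by rw [hXe]; simp [m2]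
  refine ⟨((hX _).1 k1).2.2, ((hX _).1 k2).2.2, ?_⟩
  obtain ⟨a, ha, b, hb, hab⟩ := Finset.one_lt_card.1 (show 1 < Y.card by omega)
  rw [hY] at ha hb
  exact ⟨a, ha.1, b, hb.1, hab, ha.2.1, hb.2.1, ha.2.2, hb.2.2⟩
end PB

namespace PB
variable {ι : Type} [DecidableEq ι]

lemma three_lem {α : Type} {F : Finset α} (h : F.card ≤ 3) {a b c x : α} (ha : a ∈ F) (hb : b ∈ F)
    (hc : c ∈ F) (hx : x ∈ F) (hab : a ≠ b) (hac : a ≠ c) (hbc : b ≠ c) : x = a ∨ x = b ∨ x = c := by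
  classical
  by_contra hcon
  push Not at hcon
  have h1 : ({x, a, b, c} : Finset α).card = 4 := by
    rw [Finset.card_insert_of_notMem, Finset.card_insert_of_notMem, Finset.card_pair hbc]
    · simp [hab, hac]
    · simp [hcon]
  have h2 : ({x, a, b, c} : Finset α) ⊆ F := by
    intro y hy
    simp only [Finset.mem_insert, Finset.mem_singleton] at hy
    rcases hy with rfl | rfl | rfl | rfl <;> assumption
  have := Finset.card_le_card h2
  omega

lemma notMeets {u v : Wd ι} (h : ¬ Meets u v) : ∃ k, (u k).1 = (v k).1 ∧ (u k).2 ≠ (v k).2 := by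
  unfold Meets at h
  push Not at h
  exact h

structure Ctx (V : Finset (Wd ι)) (i j : ι) (t s tj sj : Bool) (u1 u2 : Wd ι) : Prop where
  hV : Code V
  hT : TF V
  hji : j ≠ i
  m1 : u1 ∈ V
  m2 : u2 ∈ V
  u1i : u1 i = (t, s)
  u2i : u2 i = (t, s)
  u1j : u1 j = (tj, sj)
  u2j : u2 j = (tj, !sj)
  hX : ∀ x ∈ V, x i = (t, s) → x = u1 ∨ x = u2
  hn : nn V i t = 2 + nl V i t (!s)
  h3 : nl V i t (!s) ≤ 3
  hL : ∀ w, Cov V w → (w i).1 ≠ t → ∀ v ∈ V, (v i).1 = t → Meets v w → Meets u1 w ∧ Meets u2 w ∧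
        ∃ a ∈ V, ∃ b ∈ V, a ≠ b ∧ a i = (t, !s) ∧ b i = (t, !s) ∧ Meets a w ∧ Meets b w

lemma Ctx.swap {V : Finset (Wd ι)} {i j : ι} {t s tj sj : Bool} {u1 u2 : Wd ι}
    (h : Ctx V i j t s tj sj u1 u2) : Ctx V i j t s tj (!sj) u2 u1 where
  hV := h.hV
  hT := h.hT
  hji := h.hji
  m1 := h.m2
  m2 := h.m1
  u1i := h.u2i
  u2i := h.u1i
  u1j := h.u2j
  u2j := by rw [h.u1j, Bool.not_not]
  hX := fun x hx hi => (h.hX x hx hi).symm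
  hn := h.hn
  h3 := h.h3
  hL := fun w a b v c d e => by
    obtain ⟨h1, h2, h3⟩ := h.hL w a b v c d e
    exact ⟨h2, h1, h3⟩

lemma S2 {V : Finset (Wd ι)} {i j : ι} {t s tj sj : Bool} {u1 u2 : Wd ι}
    (h : Ctx V i j t s tj sj u1 u2) {w w2 : Wd ι} (hw : Cov V w) (hw2 : Cov V w2)
    (hwi : (w i).1 ≠ t) (hw2i : (w2 i).1 ≠ t) (hm : Meets u1 w) (hm2 : Meets u1 w2) :
    w2 j = w j := by
  obtain ⟨-, m2, a, ha, b, hb, hab, hai, hbi, haw, hbw⟩ :=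
    h.hL w hw hwi u1 h.m1 (by rw [h.u1i]) hm
  obtain ⟨-, m2', a', ha', b', hb', hab', hai', hbi', haw', hbw'⟩ :=
    h.hL w2 hw2 hw2i u1 h.m1 (by rw [h.u1i]) hm2
  obtain ⟨hwj, c, hc, hci, hcw, hcj⟩ := step1 h.hV h.hT hw h.hji hwi h.m1 h.m2 h.u1i h.u2i h.u1j
    h.u2j h.hX hm m2 h.h3
  obtain ⟨hwj2, c2, hc2, hc2i, hcw2, hcj2⟩ := step1 h.hV h.hT hw2 h.hji hw2i h.m1 h.m2 h.u1i h.u2i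
    h.u1j h.u2j h.hX hm2 m2' h.h3
  by_contra hne
  have hty : (w2 j).1 = (w j).1 := by rw [bne hwj, bne hwj2]
  have hsg : (w2 j).2 ≠ (w j).2 := fun e => hne (Prod.ext hty e)
  have n1 : ¬ Meets c2 w := fun h => by
    have := h j (by rw [hcj2, hty]); rw [hcj2] at this; exact hsg this
  have n2 : ¬ Meets c w2 := fun h => by
    have := h j (by rw [hcj, hty]); rw [hcj] at this; exact hsg this.symm
  obtain ⟨e, he, hei, hew, hec⟩ : ∃ e ∈ V, e i = (t, !s) ∧ Meets e w ∧ e ≠ c := by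
    by_cases h1 : a = c
    · exact ⟨b, hb, hbi, hbw, fun h2 => hab (h1.trans h2.symm)⟩
    · exact ⟨a, ha, hai, haw, h1⟩
  obtain ⟨e2, he2, he2i, hew2, hec2⟩ : ∃ e ∈ V, e i = (t, !s) ∧ Meets e w2 ∧ e ≠ c2 := by
    by_cases h1 : a' = c2
    · exact ⟨b', hb', hbi', hbw', fun h2 => hab' (h1.trans h2.symm)⟩
    · exact ⟨a', ha', hai', haw', h1⟩
  have hcc : c ≠ c2 := by rintro rfl; exact n1 hcw
  have hec2' : e ≠ c2 := by rintro rfl; exact n1 hew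
  have all : ∀ d ∈ V, d i = (t, !s) → d = c ∨ d = c2 ∨ d = e := by
    intro d hd hdi
    exact three_lem h.h3 (a := c) (b := c2) (c := e) (by simp [hc, hci]) (by simp [hc2, hc2i])
      (by simp [he, hei]) (by simp [hd, hdi]) hcc hec.symm hec2'.symm
  have hee : e2 = e := by
    rcases all e2 he2 he2i with h1 | h1 | h1
    · rw [h1] at hew2; exact absurd hew2 n2
    · exact absurd h1 hec2
    · exact h1
  rw [hee] at hew2
  have hej : (e j).1 = tj := by
    by_contra h1
    have h2 : (e j).1 = (w j).1 := by rw [bne h1, bne hwj]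
    have h3 := hew j h2
    have h4 := hew2 j (h2.trans hty.symm)
    exact hsg (h4.symm.trans h3)
  obtain ⟨u, su, hu, hui, huj, hX, hej'⟩ : ∃ u su, u ∈ V ∧ u i = (t, s) ∧ u j = (tj, su) ∧
      (∀ x ∈ V, x i = (t, s) → x = u ∨ x j = (tj, !su)) ∧ e j = (tj, !su) := by
    by_cases h1 : (e j).2 = sj
    · refine ⟨u2, !sj, h.m2, h.u2i, h.u2j, ?_, by rw [Bool.not_not]; exact Prod.ext hej h1⟩
      intro x hx hxi
      rcases h.hX x hx hxi with rfl | rfl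
      · right; rw [h.u1j, Bool.not_not]
      · left; rfl
    · refine ⟨u1, sj, h.m1, h.u1i, h.u1j, ?_, Prod.ext hej (bne h1)⟩
      intro x hx hxi
      rcases h.hX x hx hxi with rfl | rfl
      · left; rfl
      · right; rw [h.u2j]
  have g1 := G1 h.hV hw h.hji hwi hwj hu hui huj hX hc hci hcw hcj (by
    intro d hd hdi hdw
    rcases all d hd hdi with rfl | rfl | rfl
    · left; rfl
    · exact absurd hdw n1
    · right; exact hej')
  have g2 := G1 h.hV hw2 h.hji hw2i hwj2 hu hui huj hX hc2 hc2i hcw2 hcj2 (by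
    intro d hd hdi hdw
    rcases all d hd hdi with rfl | rfl | rfl
    · exact absurd hdw n2
    · left; rfl
    · right; exact hej')
  refine h.hT c2 hc2 c hc ⟨j, by rw [hcj, hcj2, hty], by rw [hcj, hcj2]; exact hsg, ?_⟩
  intro k hk
  by_cases hki : k = i
  · rw [hki, hci, hc2i]
  · rw [g1 k hki hk, g2 k hki hk]

structure Q (V : Finset (Wd ι)) (i : ι) (t s : Bool) (j : ι) (tj sj : Bool) (k : ι) (tk sk : Bool)
    (u1 u2 c e : Wd ι) (v : Bool → Wd ι) : Prop where
  hji : j ≠ i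
  hki : k ≠ i
  hkj : k ≠ j
  mu1 : u1 ∈ V
  mu2 : u2 ∈ V
  mc : c ∈ V
  me : e ∈ V
  mv : ∀ b, v b ∈ V
  u1i : u1 i = (t, s)
  u2i : u2 i = (t, s)
  ci : c i = (t, !s)
  ei : e i = (t, !s)
  vi : ∀ b, v b i = (!t, b)
  u1j : u1 j = (tj, sj)
  u2j : u2 j = (tj, !sj)
  ej : e j = (tj, sj)
  cj : (c j).1 = !tj
  vj : ∀ b, v b j = (tj, !sj)
  u1k : (u1 k).1 = !tk
  u2k : u2 k = (tk, sk)
  ck : c k = (tk, sk)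
  ek : e k = (tk, !sk)
  vk : ∀ b, v b k = (tk, !sk)
  hr : ∀ r, r ≠ i → r ≠ j → r ≠ k → u2 r = u1 r ∧ c r = u1 r ∧ e r = u1 r ∧
    (v true r ≠ v false r → ∃ b, v b r = u1 r ∧ (v (!b) r).1 ≠ (u1 r).1)
  all : nn V i t = 4 → ∀ x ∈ V, (x i).1 = t → x = u1 ∨ x = u2 ∨ x = c ∨ x = e

lemma nne {a b : Bool} (h : a ≠ b) : (!a) = b := by revert h; cases a <;> cases b <;> simp

lemma quad2 {V W : Finset (Wd ι)} {i j : ι} {t s tj sj : Bool} {u1 u2 : Wd ι}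
    (h : Ctx V i j t s tj sj u1 u2) (hW : Code W) (hE : Eqv V W) (h10 : V.card ≤ 10)
    (hmin : nn V i t ≤ nn V j (!tj)) {w : Wd ι} (hwW : w ∈ W) (hwi : (w i).1 ≠ t)
    (hm : Meets u1 w) {p : Pt ι} (hpw : Off i p w) (hpu : Off i p u1) {k0 : ι} (hk0 : k0 ≠ i)
    (hk0j : k0 ≠ j) (hpk : p k0 (u2 k0).1 ≠ (u2 k0).2) :
    ∃ k tk sk c e v, Q V i t s j tj sj k tk sk u1 u2 c e v := by
  classical
  have hw := covVW hE hwW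
  obtain ⟨-, m2, -⟩ := h.hL w hw hwi u1 h.m1 (by rw [h.u1i]) hm
  obtain ⟨hwj, c, hc, hci, hcw, hcj⟩ := step1 h.hV h.hT hw h.hji hwi h.m1 h.m2 h.u1i h.u2i h.u1j
    h.u2j h.hX hm m2 h.h3
  have hwj' := bne hwj
  have hpj : p j tj = sj := by have := hpu j h.hji; rwa [h.u1j] at this
  -- the word w'
  obtain ⟨w', hw'W, hw'⟩ := (hE (st (pu p j (!tj) (!(w j).2)) i t s (w i).2)).1 ⟨u1, h.m1, by
    rw [in_st, h.u1i]
    refine ⟨(off_pu_ne (by rw [h.u1j]; simp)).2 hpu, by simp⟩⟩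
  have hq1 : In (st (pu p j (!tj) (!(w j).2)) i t s (w i).2) u1 := by
    rw [in_st, h.u1i]
    refine ⟨(off_pu_ne (by rw [h.u1j]; simp)).2 hpu, by simp⟩
  have hw'm := hq1.meets hw'
  rw [in_st] at hw'
  obtain ⟨hqw', hw'i2⟩ := hw'
  have hw'i1 : (w' i).1 = t := by
    by_contra hne
    have e := S2 h hw (covVW hE hw'W) hwi hne hm hw'm
    have := hqw' j h.hji
    rw [e, hwj', pu_same] at this
    simp at this
  have hw'i : w' i = (t, s) := by
    rw [if_pos hw'i1] at hw'i2
    exact Prod.ext hw'i1 hw'i2.symm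
  have hw'j : (w' j).1 ≠ tj := by
    intro e
    have h1 : Off i p w' := (off_pu_ne (by rw [e]; simp)).1 hqw'
    have h2 := hW w hwW w' hw'W (hpw.meets h1 (by rw [hw'i1]; intro h; exact absurd h hwi))
    rw [h2] at hwi; exact hwi hw'i1
  set q := pu p j (!tj) (!(w j).2) with hq
  set n0 := pu q j tj (!sj) with hn0
  have hn0w : Off i n0 w' := (off_pu_ne hw'j).2 hqw'
  have hn0r : ∀ r, r ≠ j → n0 r = p r := by
    intro r hr
    rw [hn0, pu_ne _ _ _ hr, hq, pu_ne _ _ _ hr]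
  have hv : ∀ b, ∃ v ∈ V, v i = (!t, b) ∧ v j = (tj, !sj) ∧ Off i n0 v := by
    intro b
    obtain ⟨v, hv, hpv⟩ := (hE (st n0 i t s b)).2 ⟨w', hw'W, by
      rw [in_st, hw'i]; exact ⟨hn0w, by simp⟩⟩
    rw [in_st] at hpv
    obtain ⟨h1, h2⟩ := hpv
    have hvi : (v i).1 ≠ t := by
      intro e
      rw [if_pos e] at h2
      rcases h.hX v hv (Prod.ext e h2.symm) with rfl | rfl
      · have := h1 j h.hji
        rw [h.u1j, hn0, pu_same] at this
        simp at this
      · have := h1 k0 hk0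
        rw [hn0r k0 hk0j] at this
        exact hpk this
    rw [if_neg hvi] at h2
    refine ⟨v, hv, Prod.ext (bne hvi) h2.symm, ?_, h1⟩
    have hvj : (v j).1 = tj := by
      by_contra e
      have h3 : Off i q v := (off_pu_ne e).1 h1
      have h4 := h.hV u1 h.m1 v hv ((hq1.off i |> fun (hh : Off i _ u1) =>
        ((off_pu_ne (by rw [h.u1j]; simp)).2 hpu : Off i q u1)).meets h3 (by
          rw [h.u1i]; intro h; exact absurd h.symm hvi))
      rw [← h4, h.u1i] at hvi; exact hvi rfl
    have h3 := h1 j h.hji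
    rw [hvj, hn0, pu_same] at h3
    exact Prod.ext hvj h3.symm
  choose v hvV hvi hvj hvn using hv
  -- the word e
  obtain ⟨e, he, hei, hpe⟩ := exch h.hV hw hwi hpw h.m1 h.u1i hpu
  have hej1 : (e j).1 = tj := by
    by_contra hne
    have h1 : Off i (pu p j tj (!sj)) e := (off_pu_ne hne).2 hpe
    obtain ⟨x, hx, hxi, hpx⟩ := exch h.hV hw hwi ((off_pu_ne hwj).2 hpw) he hei h1
    rw [Bool.not_not] at hxi
    rcases h.hX x hx hxi with rfl | rfl
    · have := hpx j h.hji
      rw [h.u1j, pu_same] at this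
      simp at this
    · have := hpx k0 hk0
      rw [pu_ne _ _ _ hk0j] at this
      exact hpk this
  have hej : e j = (tj, sj) := by
    refine Prod.ext hej1 ?_
    have := hpe j h.hji
    rw [hej1, hpj] at this
    exact this.symm
  have hew : Meets e w := hpe.meets hpw (by rw [hei]; intro h; exact absurd h.symm hwi)
  have hce : c ≠ e := by
    rintro rfl
    rw [hcj] at hej1; exact hwj hej1
  -- step 5
  have hXu2 : ∀ x ∈ V, x i = (t, s) → x = u2 ∨ x j = (tj, !(!sj)) := by
    intro x hx hxi
    rcases h.hX x hx hxi with rfl | rfl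
    · right; rw [h.u1j, Bool.not_not]
    · left; rfl
  have hY : ∀ d ∈ V, d i = (t, !s) → Meets d w → d = c ∨ d = e := by
    intro d hd hdi hdw
    by_contra hcon
    push Not at hcon
    obtain ⟨hdc, hde⟩ := hcon
    have all : ∀ d' ∈ V, d' i = (t, !s) → d' = c ∨ d' = e ∨ d' = d := by
      intro d' hd' hdi'
      exact three_lem h.h3 (a := c) (b := e) (c := d) (by simp [hc, hci]) (by simp [he, hei])
        (by simp [hd, hdi]) (by simp [hd', hdi']) hce hdc.symm hde.symm
    have n3 : 3 ≤ nl V i t (!s) := by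
      have h1 : ({c, e, d} : Finset (Wd ι)).card = 3 := by
        rw [Finset.card_insert_of_notMem, Finset.card_pair hde.symm]
        simp [hce, hdc.symm]
      rw [← h1]
      apply Finset.card_le_card
      intro y hy
      simp only [Finset.mem_insert, Finset.mem_singleton] at hy
      simp only [Finset.mem_filter]
      rcases hy with rfl | rfl | rfl <;> exact ⟨by assumption, by assumption⟩
    have hdj1 : (d j).1 ≠ tj := by
      intro hdj
      have e1 := h.hn
      have e2 := nn_total V j tj
      have h1 : ({d, e, u1, u2, v true, v false} : Finset (Wd ι)).card = 6 := by
        have ne_i : ∀ x y : Wd ι, x i ≠ y i → x ≠ y := fun x y h1 h2 => h1 (by rw [h2])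
        have a1 : u1 ≠ u2 := by
          intro e; have := h.u1j; rw [e, h.u2j] at this; simp at this
        rw [Finset.card_insert_of_notMem, Finset.card_insert_of_notMem,
          Finset.card_insert_of_notMem, Finset.card_insert_of_notMem, Finset.card_pair]
        · apply ne_i; rw [hvi, hvi]; simp
        · simp only [Finset.mem_insert, Finset.mem_singleton, not_or]
          constructor <;> (apply ne_i; rw [h.u2i, hvi]; simp)
        · simp only [Finset.mem_insert, Finset.mem_singleton, not_or]
          refine ⟨a1, ?_, ?_⟩ <;> (apply ne_i; rw [h.u1i, hvi]; simp)
        · simp only [Finset.mem_insert, Finset.mem_singleton, not_or]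
          refine ⟨?_, ?_, ?_, ?_⟩ <;> (apply ne_i; simp [h.u1i, h.u2i, hvi, hei])
        · simp only [Finset.mem_insert, Finset.mem_singleton, not_or]
          refine ⟨hde, ?_, ?_, ?_, ?_⟩ <;> (apply ne_i; simp [h.u1i, h.u2i, hvi, hdi])
      have h2 : ({d, e, u1, u2, v true, v false} : Finset (Wd ι)) ⊆
          V.filter (fun v => (v j).1 = tj) := by
        intro y hy
        simp only [Finset.mem_insert, Finset.mem_singleton] at hy
        simp only [Finset.mem_filter]
        rcases hy with rfl | rfl | rfl | rfl | rfl | rfl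
        · exact ⟨hd, hdj⟩
        · exact ⟨he, hej1⟩
        · exact ⟨h.m1, by rw [h.u1j]⟩
        · exact ⟨h.m2, by rw [h.u2j]⟩
        · exact ⟨hvV _, by rw [hvj]⟩
        · exact ⟨hvV _, by rw [hvj]⟩
      have h3 : 6 ≤ nn V j tj := by rw [← h1]; exact Finset.card_le_card h2
      omega
    have hdj : d j = w j := by
      have h1 : (d j).1 = (w j).1 := by rw [bne hdj1, hwj']
      exact Prod.ext h1 (hdw j h1)
    have g2 := G2 h.hV hw h.hji hwi hwj h.m2 h.u2i h.u2j hXu2 (by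
      intro d' hd' hdi' _
      rcases all d' hd' hdi' with rfl | rfl | rfl
      · left; exact hcj
      · right; rw [hej, Bool.not_not]
      · left; exact hdj)
    obtain ⟨k1, hk1, hk2⟩ := notMeets (fun hh => hdc (h.hV c hc d hd hh).symm)
    have hk1i : k1 ≠ i := by rintro rfl; rw [hci, hdi] at hk2; exact hk2 rfl
    have hk1j : k1 ≠ j := by rintro rfl; rw [hcj, hdj] at hk2; exact hk2 rfl
    obtain ⟨pc, hpc1, hpc2⟩ := hcw.pt
    obtain ⟨pd, hpd1, hpd2⟩ := hdw.pt
    obtain ⟨-, h5⟩ := two_lem hk1i (w := w) (A := c) (B := d) (C := Function.update u2 j (w j))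
      ⟨pc, hpc2.off i, hpc1.off i⟩ ⟨pd, hpd2.off i, hpd1.off i⟩ hk1 hk2 (by
        intro p' hp'
        rw [g2 p' hp']
        constructor
        · rintro ⟨d', hd', hdi', hdj', hpd'⟩
          rcases all d' hd' hdi' with rfl | rfl | rfl
          · left; exact hpd'
          · rw [hdj'] at hej1; exact absurd hej1 hwj
          · right; exact hpd'
        · rintro (h1 | h1)
          · exact ⟨c, hc, hci, hcj, h1⟩
          · exact ⟨d, hd, hdi, hdj, h1⟩)
    refine h.hT c hc d hd ⟨k1, hk1, hk2, ?_⟩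
    intro k hk
    by_cases hki : k = i
    · rw [hki, hci, hdi]
    · rw [(h5 k hki hk).1, (h5 k hki hk).2]
  -- step 6
  have hcu2 := G1 h.hV hw h.hji hwi hwj h.m2 h.u2i h.u2j hXu2 hc hci hcw hcj (by
    intro d hd hdi hdw
    rcases hY d hd hdi hdw with rfl | rfl
    · left; rfl
    · right; rw [hej, Bool.not_not])
  obtain ⟨k, hk1, hk2⟩ := notMeets (fun hh => hce (h.hV c hc e he hh))
  have hki : k ≠ i := by rintro rfl; rw [hci, hei] at hk2; exact hk2 rfl
  have hkj : k ≠ j := by rintro rfl; rw [hcj, hej1] at hk1; exact hwj hk1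
  obtain ⟨pc, hpc1, hpc2⟩ := hcw.pt
  obtain ⟨pe, hpe1, hpe2⟩ := hew.pt
  obtain ⟨hu1k, h6⟩ := two_lem hki (w := w) (A := Function.update c j (tj, sj)) (B := e) (C := u1)
    ⟨pu pc j tj sj, (off_pu_ne hwj).2 (hpc2.off i), by
      rw [off_upd h.hji]
      refine ⟨fun r h1 h2 => ?_, by simp only [pu_same]⟩
      rw [pu_ne _ _ _ h2]; exact hpc1 r⟩
    ⟨pe, hpe2.off i, hpe1.off i⟩ (by simpa [hkj] using hk1) (by simpa [hkj] using hk2) (by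
      intro p' hp'
      constructor
      · intro h1
        obtain ⟨d, hd, hdi, hpd⟩ := exch h.hV hw hwi hp' h.m1 h.u1i h1
        have hdw : Meets d w := hpd.meets hp' (by rw [hdi]; intro h; exact absurd h.symm hwi)
        rcases hY d hd hdi hdw with rfl | rfl
        · left
          rw [off_upd h.hji]
          refine ⟨fun r h1 h2 => hpd r h1, ?_⟩
          have := h1 j h.hji
          rwa [h.u1j] at this
        · right; exact hpd
      · intro h1
        have key : ∀ x ∈ V, x i = (t, !s) → Off i p' x → p' j tj = sj → Off i p' u1 := by
          intro x hx hxi hpx hj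
          obtain ⟨y, hy, hyi, hpy⟩ := exch h.hV hw hwi hp' hx hxi hpx
          rw [Bool.not_not] at hyi
          rcases h.hX y hy hyi with rfl | rfl
          · exact hpy
          · have := hpy j h.hji
            rw [h.u2j] at this
            simp only [hj] at this
            simp at this
        rcases h1 with h1 | h1
        · rw [off_upd h.hji] at h1
          refine key c hc hci ((off_split h.hji).2 ⟨h1.1, ?_⟩) h1.2
          rw [hcj]; exact hp' j h.hji
        · refine key e he hei h1 ?_
          have := h1 j h.hji
          rwa [hej] at this)
  have hcr : ∀ r, r ≠ i → r ≠ j → r ≠ k → c r = u1 r := by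
    intro r h1 h2 h3
    have := (h6 r h1 h3).1
    simpa [h2] using this
  have her : ∀ r, r ≠ i → r ≠ k → e r = u1 r := fun r h1 h3 => (h6 r h1 h3).2
  have hu1k' : (u1 k).1 ≠ (c k).1 := by
    intro h1
    rw [hu1k] at h1
    have h2 := hcw k h1.symm
    have h3 := hew k (hk1.symm.trans h1.symm)
    exact hk2 (h2.trans h3.symm)
  have hur : ∀ r, r ≠ i → r ≠ j → r ≠ k → u2 r = u1 r := by
    intro r h1 h2 h3
    rw [← hcu2 r h1 h2, hcr r h1 h2 h3]
  refine ⟨k, (c k).1, (c k).2, c, e, v, 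
    { hji := h.hji, hki := hki, hkj := hkj, mu1 := h.m1, mu2 := h.m2, mc := hc, me := he, mv := hvV,
      u1i := h.u1i, u2i := h.u2i, ci := hci, ei := hei, vi := hvi, u1j := h.u1j, u2j := h.u2j,
      ej := hej, cj := by rw [hcj, hwj'], vj := hvj, u1k := bne hu1k', u2k := (hcu2 k hki hkj).symm,
      ck := rfl, ek := Prod.ext hk1.symm (bne hk2.symm), vk := ?_, hr := ?_, all := ?_ }⟩
  · intro b
    obtain ⟨k1, h1, h2⟩ := notMeets (fun hh => by
      have := h.hV _ (hvV b) u2 h.m2 hh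
      have h1 := hvi b
      rw [this, h.u2i] at h1
      simp at h1 : ¬ Meets (v b) u2)
    have a1 : k1 ≠ i := by rintro rfl; rw [hvi, h.u2i] at h1; simp at h1
    have a2 : k1 ≠ j := by rintro rfl; rw [hvj, h.u2j] at h2; simp at h2
    by_cases a3 : k1 = k
    · subst a3
      rw [← hcu2 k1 hki hkj] at h1 h2
      exact Prod.ext h1 (bne h2)
    · exfalso
      rw [hur k1 a1 a2 a3] at h1 h2
      apply h2
      have h3 := hvn b k1 a1
      have h4 := hpu k1 a1
      rw [hn0r k1 a2, h1] at h3
      rw [← h3, h4]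
  · intro r h1 h2 h3
    refine ⟨hur r h1 h2 h3, hcr r h1 h2 h3, her r h1 h3, ?_⟩
    intro hne
    have f : ∀ b, p r (v b r).1 = (v b r).2 := by
      intro b
      have := hvn b r h1
      rwa [hn0r r h2] at this
    have g : ∀ b, (v b r).1 = (u1 r).1 → v b r = u1 r := by
      intro b hb
      refine Prod.ext hb ?_
      rw [← f b, hb, hpu r h1]
    have hty : (v true r).1 ≠ (v false r).1 := by
      intro e1
      exact hne (Prod.ext e1 (by rw [← f true, ← f false, e1]))
    by_cases hb : (v true r).1 = (u1 r).1
    · exact ⟨true, g _ hb, by rw [← hb]; exact hty.symm⟩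
    · refine ⟨false, g _ ?_, hb⟩
      rw [bne hty] at hb
      exact (bne hty.symm).trans (by rw [bne hty]; exact nne (fun e => hb (by rw [e])))
  · intro h4 x hx hxi
    have hn := h.hn
    by_cases hxs : (x i).2 = s
    · rcases h.hX x hx (Prod.ext hxi hxs) with h | h
      · exact Or.inl h
      · exact Or.inr (Or.inl h)
    · right; right
      have hxi' : x i = (t, !s) := Prod.ext hxi (bne hxs)
      have n2 : (V.filter (fun v => v i = (t, !s))).card = 2 := by unfold nl at hn; omega
      have : ({c, e} : Finset (Wd ι)) = V.filter (fun v => v i = (t, !s)) := by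
        apply Finset.eq_of_subset_of_card_le
        · intro y hy
          simp only [Finset.mem_insert, Finset.mem_singleton] at hy
          simp only [Finset.mem_filter]
          rcases hy with rfl | rfl <;> exact ⟨by assumption, by assumption⟩
        · rw [n2, Finset.card_pair hce]
      have hx' : x ∈ V.filter (fun v => v i = (t, !s)) := by simp [hx, hxi']
      rw [← this] at hx'
      simpa using hx'
end PB

namespace PB
variable {ι : Type} [DecidableEq ι]

lemma quad {V W : Finset (Wd ι)} (hV : Code V) (hT : TF V) (hW : Code W) (hE : Eqv V W)
    (h10 : V.card ≤ 10) {i : ι} {t : Bool}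
    (hA : ∃ v ∈ V, ∃ w ∈ W, (v i).1 = t ∧ (w i).1 ≠ t ∧ Meets v w) (h5 : nn V i t ≤ 5)
    (hmin : ∀ j, (∃ v ∈ V, ∃ v' ∈ V, v j ≠ v' j) → ∀ t', nn V i t ≤ nn V j t') :
    ∃ s j tj sj k tk sk u1 u2 c e v, Q V i t s j tj sj k tk sk u1 u2 c e v := by
  obtain ⟨v, hv, w, hw, hvi, hwi, hm⟩ := hA
  have hwc := covVW hE hw
  obtain ⟨s, u1, hu1, u2, hu2, hne, hu1i, hu2i, hX, hn, h3, hL⟩ :=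
    light hV hT h5 ⟨v, hv, w, hwc, hvi, hwi, hm⟩
  obtain ⟨m1, m2, -⟩ := hL w hwc hwi v hv hvi hm
  obtain ⟨j, hj1, hj2⟩ := notMeets (fun hh => hne (hV u1 hu1 u2 hu2 hh))
  have hji : j ≠ i := by rintro rfl; rw [hu1i, hu2i] at hj2; exact hj2 rfl
  have ctx : Ctx V i j t s (u1 j).1 (u1 j).2 u1 u2 :=
    { hV := hV, hT := hT, hji := hji, m1 := hu1, m2 := hu2, u1i := hu1i, u2i := hu2i, u1j := rfl,
      u2j := Prod.ext hj1.symm (bne hj2.symm), hX := hX, hn := hn, h3 := h3, hL := hL }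
  have hmj := hmin j ⟨u1, hu1, u2, hu2, fun e => hj2 (by rw [e])⟩
  obtain ⟨hwj, -⟩ := step1 hV hT hwc hji hwi hu1 hu2 hu1i hu2i ctx.u1j ctx.u2j hX m1 m2 h3
  have key : ∃ p, Off i p w ∧ ¬ (Off i p (Function.update u1 j (w j)) ↔
      Off i p (Function.update u2 j (w j))) := by
    by_contra hcon
    push Not at hcon
    obtain ⟨p, hp1, hp2⟩ := m1.pt
    have := eq_lem (hp2.off i) ((off_upd hji).2 ⟨fun k _ _ => hp1 k, hp2 j⟩) hcon
    refine hT u1 hu1 u2 hu2 ⟨j, hj1, hj2, ?_⟩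
    intro k hk
    by_cases hki : k = i
    · rw [hki, hu1i, hu2i]
    · have := this k hki
      simpa [hk] using this.symm
  obtain ⟨p, hpw, hp⟩ := key
  have gen : ∀ (u1 u2 : Wd ι) (sj : Bool), Ctx V i j t s (u1 j).1 sj u1 u2 → (w j).1 ≠ (u1 j).1 →
      Meets u1 w →
      Off i p (Function.update u1 j (w j)) → ¬ Off i p (Function.update u2 j (w j)) →
      ∃ s j tj sj k tk sk u1 u2 c e v, Q V i t s j tj sj k tk sk u1 u2 c e v := by
    intro u1 u2 sj ctx hwj m1 h1 h2
    rw [off_upd hji] at h1 h2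
    have : ∃ k0, k0 ≠ i ∧ k0 ≠ j ∧ p k0 (u2 k0).1 ≠ (u2 k0).2 := by
      by_contra hcon
      push Not at hcon
      exact h2 ⟨hcon, hpw j hji⟩
    obtain ⟨k0, hk0, hk0j, hpk⟩ := this
    obtain ⟨k, tk, sk, c, e, v, hQ⟩ := quad2 ctx hW hE h10 (hmj _) hw hwi m1
      (p := pu p j (u1 j).1 sj) ((off_pu_ne hwj).2 hpw) (by
        rw [off_split hji]
        refine ⟨fun k a b => ?_, by rw [pu_same, ctx.u1j]⟩
        rw [pu_ne _ _ _ b]; exact h1.1 k a b) hk0 hk0j (by rw [pu_ne _ _ _ hk0j]; exact hpk)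
    exact ⟨s, j, _, _, k, tk, sk, u1, u2, c, e, v, hQ⟩
  by_cases h1 : Off i p (Function.update u1 j (w j))
  · exact gen u1 u2 _ ctx hwj m1 h1 (fun h2 => hp ⟨fun _ => h2, fun _ => h1⟩)
  · refine gen u2 u1 (!(u1 j).2) (by rw [← hj1]; exact ctx.swap) (by rw [← hj1]; exact hwj) m2 ?_ h1
    by_contra h2
    exact hp ⟨fun h => absurd h h1, fun h => absurd h h2⟩

lemma final {V W : Finset (Wd ι)} (hV : Code V) (hT : TF V) (hW : Code W) (hE : Eqv V W)
    (h10 : V.card ≤ 10) (hNC : ∃ i, ∃ v ∈ V, ∃ v' ∈ V, v i ≠ v' i)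
    (hA : ∀ i, (∃ v ∈ V, ∃ v' ∈ V, v i ≠ v' i) → ∀ t,
      ∃ v ∈ V, ∃ w ∈ W, (v i).1 = t ∧ (w i).1 ≠ t ∧ Meets v w) : False := by
  classical
  have hA4 : ∀ i, (∃ v ∈ V, ∃ v' ∈ V, v i ≠ v' i) → ∀ t, 4 ≤ nn V i t ∧ ∀ s, 1 ≤ nl V i t s := by
    intro i hi t
    obtain ⟨v, hv, w, hw, h⟩ := hA i hi t
    exact ge4 hV hT ⟨v, hv, w, covVW hE hw, h⟩
  obtain ⟨i, t, hi, hmin⟩ : ∃ i t, (∃ v ∈ V, ∃ v' ∈ V, v i ≠ v' i) ∧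
      ∀ j, (∃ v ∈ V, ∃ v' ∈ V, v j ≠ v' j) → ∀ t', nn V i t ≤ nn V j t' := by
    have hex : ∃ n, ∃ i, (∃ v ∈ V, ∃ v' ∈ V, v i ≠ v' i) ∧ ∃ t, nn V i t = n := by
      obtain ⟨i, hi⟩ := hNC
      exact ⟨_, i, hi, true, rfl⟩
    obtain ⟨i, hi, t, ht⟩ := Nat.find_spec hex
    refine ⟨i, t, hi, fun j hj t' => ?_⟩
    rw [ht]
    exact Nat.find_min' hex ⟨j, hj, t', rfl⟩
  have h5 : nn V i t ≤ 5 := by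
    have h1 := hmin i hi (!t)
    have h2 := nn_total V i t
    omega
  obtain ⟨s, j, tj, sj, k, tk, sk, u1, u2, c, e, v, q⟩ := quad hV hT hW hE h10 (hA i hi t) h5 hmin
  obtain ⟨r, hri, hrne⟩ : ∃ r, r ≠ i ∧ v true r ≠ v false r := by
    by_contra hcon
    push Not at hcon
    exact hT _ (q.mv true) _ (q.mv false) ⟨i, by rw [q.vi, q.vi], by rw [q.vi, q.vi]; simp, hcon⟩
  have hrj : r ≠ j := by rintro rfl; rw [q.vj, q.vj] at hrne; exact hrne rfl
  have hrk : r ≠ k := by rintro rfl; rw [q.vk, q.vk] at hrne; exact hrne rfl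
  obtain ⟨hu2r, hcr, her, hb⟩ := q.hr r hri hrj hrk
  obtain ⟨b, hzr, hzr'⟩ := hb hrne
  have hrNC : ∃ v ∈ V, ∃ v' ∈ V, v r ≠ v' r :=
    ⟨v true, q.mv true, v false, q.mv false, hrne⟩
  obtain ⟨τ, σ, hR⟩ : ∃ τ σ, u1 r = (τ, σ) := ⟨_, _, rfl⟩
  rw [hR] at hu2r hcr her hzr hzr'
  have ne_i : ∀ x y : Wd ι, ∀ l, x l ≠ y l → x ≠ y := fun x y l h1 h2 => h1 (by rw [h2])
  have n5 : ({u1, u2, c, e, v b} : Finset (Wd ι)).card = 5 := by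
    rw [Finset.card_insert_of_notMem, Finset.card_insert_of_notMem,
      Finset.card_insert_of_notMem, Finset.card_pair]
    · apply ne_i _ _ i; rw [q.ei, q.vi]; simp
    · simp only [Finset.mem_insert, Finset.mem_singleton, not_or]
      refine ⟨ne_i _ _ k (by rw [q.ck, q.ek]; simp), ne_i _ _ i (by rw [q.ci, q.vi]; simp)⟩
    · simp only [Finset.mem_insert, Finset.mem_singleton, not_or]
      refine ⟨?_, ?_, ?_⟩ <;> (apply ne_i _ _ i; simp [q.u2i, q.ci, q.ei, q.vi])
    · simp only [Finset.mem_insert, Finset.mem_singleton, not_or]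
      refine ⟨ne_i _ _ j (by rw [q.u1j, q.u2j]; simp), ?_, ?_, ?_⟩ <;>
        (apply ne_i _ _ i; simp [q.u1i, q.ci, q.ei, q.vi])
  have s5 : ({u1, u2, c, e, v b} : Finset (Wd ι)) ⊆ V.filter (fun x => x r = (τ, σ)) := by
    intro y hy
    simp only [Finset.mem_insert, Finset.mem_singleton] at hy
    simp only [Finset.mem_filter]
    rcases hy with rfl | rfl | rfl | rfl | rfl
    · exact ⟨q.mu1, hR⟩
    · exact ⟨q.mu2, hu2r⟩
    · exact ⟨q.mc, hcr⟩
    · exact ⟨q.me, her⟩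
    · exact ⟨q.mv b, hzr⟩
  have c5 : 5 ≤ nl V r τ σ := by rw [← n5]; exact Finset.card_le_card s5
  have c1 := (hA4 r hrNC τ).2 (!σ)
  have c4 := (hA4 r hrNC (!τ)).1
  have ct := nn_total V r τ
  have cs := nn_split V r τ σ
  have ci4 := (hA4 i hi t).1
  have cm := hmin r hrNC (!τ)
  have e1 : nl V r τ (!σ) = 1 := by omega
  have e5 : nl V r τ σ = 5 := by omega
  have e4 : nn V r (!τ) = 4 := by omega
  have ei : nn V i t = 4 := by omega
  have five : ∀ x ∈ V, x r = (τ, σ) → x = u1 ∨ x = u2 ∨ x = c ∨ x = e ∨ x = v b := by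
    intro x hx hxr
    have := Finset.eq_of_subset_of_card_le s5 (by rw [n5]; exact e5.le)
    have hx' : x ∈ V.filter (fun x => x r = (τ, σ)) := by simp [hx, hxr]
    rw [← this] at hx'
    simpa using hx'
  obtain ⟨ρ, hρ⟩ := Finset.card_eq_one.1 e1
  have hρm : ∀ x, (x ∈ V ∧ x r = (τ, !σ)) ↔ x = ρ := by
    intro x
    have : x ∈ V.filter (fun v => v r = (τ, !σ)) ↔ x = ρ := by rw [hρ]; simp
    simpa using this
  obtain ⟨hρV, hρr⟩ := (hρm ρ).2 rfl
  obtain ⟨v3, hv3, w3, hw3, hv3r, hw3r, hm3⟩ := hA r hrNC τ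
  have hw3c := covVW hE hw3
  obtain ⟨X, Y, hX, hY, hXs, hYs, hXc, hYc, hsz⟩ := sizes' hV hT hw3c hw3r hv3 hv3r hm3 σ
  have hX5 : X = V.filter (fun v => v r = (τ, σ)) :=
    Finset.eq_of_subset_of_card_le hXs (by unfold nl at e5; omega)
  have hY1 : Y = V.filter (fun v => v r = (τ, !σ)) :=
    Finset.eq_of_subset_of_card_le hYs (by unfold nl at e1; omega)
  have meets5 : ∀ x ∈ V, x r = (τ, σ) → Meets x w3 := by
    intro x hx hxr
    have : x ∈ X := by rw [hX5]; simp [hx, hxr]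
    exact ((hX x).1 this).2.2
  have meetsρ : Meets ρ w3 := by
    have : ρ ∈ Y := by rw [hY1]; simp [hρV, hρr]
    exact ((hY ρ).1 this).2.2
  have mu1 := meets5 u1 q.mu1 hR
  have mu2 := meets5 u2 q.mu2 hu2r
  have mc := meets5 c q.mc hcr
  have me := meets5 e q.me her
  obtain ⟨hT1, -⟩ := lemT hV hw3c hw3r hρV hρr meetsρ (fun u hu hur _ => (hρm u).1 ⟨hu, hur⟩)
  simp only [Bool.not_not] at hT1
  -- common pattern
  have pat : ∀ (x y z : Wd ι) (l : ι) (tl sl : Bool), l ≠ r → x ∈ V → x r = (τ, σ) → y ∈ V →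
      y r = (τ, σ) → z ∈ V → z r = (τ, σ) → x l = (tl, sl) → y l = (tl, !sl) → (z l).1 = !tl →
      ρ l = z l := by
    intro x y z l tl sl hl hx hxr hy hyr hz hzr hxl hyl hzl
    have mx := meets5 x hx hxr
    have my := meets5 y hy hyr
    have mz := meets5 z hz hzr
    have hwl : (w3 l).1 ≠ tl := by
      intro h
      have h1 := mx l (by rw [hxl, h])
      have h2 := my l (by rw [hyl, h])
      rw [hxl] at h1; rw [hyl] at h2
      rw [← h1] at h2
      simp at h2
    have hzw : z l = w3 l := by
      have h1 : (z l).1 = (w3 l).1 := by rw [hzl, bne hwl]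
      exact Prod.ext h1 (mz l h1)
    rw [hzw]
    rcases hT1 x hx hxr mx l hl with h1 | h1
    · exact h1
    rcases hT1 y hy hyr my l hl with h2 | h2
    · exact h2
    rw [hxl] at h1; rw [hyl, h1] at h2
    simp at h2
  have hρj : ρ j = c j := pat u1 u2 c j tj sj hrj.symm q.mu1 hR q.mu2 hu2r q.mc hcr q.u1j q.u2j q.cj
  have hρk : ρ k = u1 k := pat u2 e u1 k tk sk hrk.symm q.mu2 hu2r q.me her q.mu1 hR q.u2k q.ek q.u1k
  -- second quadruple
  obtain ⟨s2, j2, tj2, sj2, k2, tk2, sk2, a1, a2, a3, a4, v2, q2⟩ :=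
    quad hV hT hW hE h10 (hA r hrNC (!τ)) (by omega) (by
      intro l hl t'
      rw [e4, ← ei]; exact hmin l hl t')
  have hall := q2.all e4
  have hg1 := q2.vi (!σ)
  have hg2 := q2.vi σ
  rw [Bool.not_not] at hg1 hg2
  have hgρ := (hρm _).1 ⟨q2.mv (!σ), hg1⟩
  have hg5 := five _ (q2.mv σ) hg2
  have hgj2 : v2 σ j2 = ρ j2 := by rw [← hgρ, q2.vj, q2.vj]
  have hgk2 : v2 σ k2 = ρ k2 := by rw [← hgρ, q2.vk, q2.vk]
  have hzs : (v (!b) r).1 = !τ := bne hzr'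
  -- class of all words
  have cls : ∀ (l : ι) (tl : Bool) (y : Wd ι), l ≠ r → (v (!b) l).1 = tl →
      (∀ x ∈ V, x r = (τ, σ) → (x l).1 = (!tl) → x = y) →
      (∃ v ∈ V, ∃ v' ∈ V, v l ≠ v' l) → v2 σ l = ρ l := by
    intro l tl y hl hzl hy hlNC
    by_cases h1 : l = j2
    · rw [h1]; exact hgj2
    by_cases h2 : l = k2
    · rw [h2]; exact hgk2
    exfalso
    obtain ⟨f2, f3, f4, -⟩ := q2.hr l hl h1 h2
    have hc : ∀ x ∈ V, (x r).1 = (!τ) → x l = a1 l := by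
      intro x hx hxr
      rcases hall x hx hxr with rfl | rfl | rfl | rfl
      · rfl
      · exact f2
      · exact f3
      · exact f4
    have hsub : V.filter (fun x => (x l).1 = !tl) ⊆ {y, ρ} := by
      intro x hx
      simp only [Finset.mem_filter] at hx
      simp only [Finset.mem_insert, Finset.mem_singleton]
      by_cases g1 : (x r).1 = τ
      · by_cases g2 : (x r).2 = σ
        · left; exact hy x hx.1 (Prod.ext g1 g2) hx.2
        · right; exact (hρm x).1 ⟨hx.1, Prod.ext g1 (bne g2)⟩
      · exfalso
        have g3 := hc x hx.1 (bne g1)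
        rw [← hc _ (q.mv (!b)) hzs] at g3
        have := hx.2
        rw [g3, hzl] at this
        simp at this
    have h3 := Finset.card_le_card hsub
    have h4 : ({y, ρ} : Finset (Wd ι)).card ≤ 2 := Finset.card_le_two
    have h5 := (hA4 l hlNC (!tl)).1
    unfold nn at h5
    omega
  have hj' := cls j tj c hrj.symm (by rw [q.vj]) (by
    intro x hx hxr hxj
    rcases five x hx hxr with h | h | h | h | h
    · rw [h, q.u1j] at hxj; simp at hxj
    · rw [h, q.u2j] at hxj; simp at hxj
    · exact h
    · rw [h, q.ej] at hxj; simp at hxj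
    · rw [h, q.vj] at hxj; simp at hxj)
    ⟨u1, q.mu1, u2, q.mu2, by rw [q.u1j, q.u2j]; simp⟩
  have hk' := cls k tk u1 hrk.symm (by rw [q.vk]) (by
    intro x hx hxr hxj
    rcases five x hx hxr with h | h | h | h | h
    · exact h
    · rw [h, q.u2k] at hxj; simp at hxj
    · rw [h, q.ck] at hxj; simp at hxj
    · rw [h, q.ek] at hxj; simp at hxj
    · rw [h, q.vk] at hxj; simp at hxj)
    ⟨u2, q.mu2, e, q.me, by rw [q.u2k, q.ek]; simp⟩
  have hj1 : (v2 σ j).1 = !tj := by rw [hj', hρj, q.cj]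
  have hk1 : (v2 σ k).1 = !tk := by rw [hk', hρk, q.u1k]
  rcases hg5 with h | h | h | h | h
  · rw [h, q.u1j] at hj1; simp at hj1
  · rw [h, q.u2j] at hj1; simp at hj1
  · rw [h, q.ck] at hk1; simp at hk1
  · rw [h, q.ej] at hj1; simp at hj1
  · rw [h, q.vj] at hj1; simp at hj1

theorem core : ∀ (n : ℕ) (V W : Finset (Wd ι)), V.card = n → V.card ≤ 10 → Code V → Code W → TF V →
    Eqv V W → V = W := by
  classical
  intro n
  induction n using Nat.strong_induction_on with
  | _ n ih =>
  intro V W hn h10 hV hW hT hE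
  have hex : ∀ x : Wd ι, ∃ p, In p x := fun x => by
    obtain ⟨p, hp, -⟩ := Meets.pt (u := x) (v := x) (fun _ _ => rfl)
    exact ⟨p, hp⟩
  by_cases hD : ∀ v ∈ V, v ∉ W
  · rcases V.eq_empty_or_nonempty with rfl | ⟨v0, hv0⟩
    · symm
      rw [Finset.eq_empty_iff_forall_notMem]
      intro w hw
      obtain ⟨p, hp⟩ := hex w
      obtain ⟨v, hv, -⟩ := (hE p).2 ⟨w, hw, hp⟩
      simp at hv
    · exfalso
      have IH : ∀ V' W' : Finset (Wd ι), V'.card < V.card → V' ⊆ V → Code V' → Code W' → TF V' →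
          Eqv V' W' → V' = W' := fun V' W' h1 h2 h3 h4 h5 h6 =>
        ih V'.card (hn ▸ h1) V' W' rfl (by omega) h3 h4 h5 h6
      refine final hV hT hW hE h10 ?_ (fun i hi t => lemA hV hW hT hE hD h10 IH i hi t)
      by_contra hcon
      push Not at hcon
      have hV1 : V = {v0} := by
        rw [Finset.eq_singleton_iff_unique_mem]
        exact ⟨hv0, fun x hx => funext fun i => hcon i x hx v0 hv0⟩
      obtain ⟨p, hp⟩ := hex v0
      obtain ⟨w, hw, -⟩ := (hE p).1 ⟨v0, hv0, hp⟩
      have := lemC _ V rfl hV hT w (fun h => hD w h hw) (covVW hE hw)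
      rw [hV1] at this
      simp at this
  · push Not at hD
    obtain ⟨v0, hv0, hv0W⟩ := hD
    have hlt : (V \ W).card < V.card := by
      apply Finset.card_lt_card
      rw [Finset.ssubset_iff_of_subset Finset.sdiff_subset]
      exact ⟨v0, hv0, by simp [hv0W]⟩
    have hsub : V \ W ⊆ V := Finset.sdiff_subset
    have heq := ih _ (hn ▸ hlt) (V \ W) (W \ V) rfl (by omega) (hV.mono hsub)
      (hW.mono Finset.sdiff_subset) (hT.mono hsub) (by
        intro p
        constructor
        · rintro ⟨v, hv, hp⟩
          simp only [Finset.mem_sdiff] at hv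
          obtain ⟨w, hw, hpw⟩ := (hE p).1 ⟨v, hv.1, hp⟩
          refine ⟨w, Finset.mem_sdiff.2 ⟨hw, fun h => ?_⟩, hpw⟩
          have := hV.eq hv.1 h hp hpw
          exact hv.2 (this ▸ hw)
        · rintro ⟨w, hw, hp⟩
          simp only [Finset.mem_sdiff] at hw
          obtain ⟨v, hv, hpv⟩ := (hE p).2 ⟨w, hw.1, hp⟩
          refine ⟨v, Finset.mem_sdiff.2 ⟨hv, fun h => ?_⟩, hpv⟩
          have := hW.eq hw.1 h hp hpv
          exact hw.2 (this ▸ hv))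
    have h1 : ∀ x ∈ V, x ∈ W := by
      intro x hx
      by_contra hxW
      have : x ∈ V \ W := Finset.mem_sdiff.2 ⟨hx, hxW⟩
      rw [heq] at this
      exact hxW (Finset.mem_sdiff.1 this).1
    have h2 : ∀ x ∈ W, x ∈ V := by
      intro x hx
      by_contra hxW
      have : x ∈ W \ V := Finset.mem_sdiff.2 ⟨hx, hxW⟩
      rw [← heq] at this
      exact hxW (Finset.mem_sdiff.1 this).1
    ext x
    exact ⟨h1 x, h2 x⟩
end PB

namespace PB

def enc : Fin 4 → Bool × Bool := ![(true, true), (true, false), (false, true), (false, false)]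

lemma enc_inj : Function.Injective enc := by decide
lemma enc_compl : ∀ s, enc (compl4 s) = ((enc s).1, !(enc s).2) := by decide
lemma enc_opp : ∀ s s', (enc s).1 = (enc s').1 → (enc s).2 ≠ (enc s').2 → s' = compl4 s := by decide

def encw {d : ℕ} (v : Fin d → Fin 4) : Wd (Fin d) := fun i => enc (v i)

lemma encw_inj {d : ℕ} : Function.Injective (encw (d := d)) := by
  intro u v h
  funext i
  exact enc_inj (congrFun h i)

def ptset {d : ℕ} (p : Pt (Fin d)) : Fin d → Set (Fin 4) := fun i => {s | p i (enc s).1 = (enc s).2}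

lemma mem_box {d : ℕ} (p : Pt (Fin d)) (v : Fin d → Fin 4) :
    ptset p ∈ WordBox compl4 v ↔ In p (encw v) := by
  constructor
  · intro h i; exact (h i).2
  · intro h i
    refine ⟨?_, h i⟩
    intro s
    simp only [ptset, Set.mem_setOf_eq, enc_compl]
    cases p i (enc s).1 <;> cases (enc s).2 <;> simp [Xor']

lemma code_enc {d : ℕ} {V : Finset (Fin d → Fin 4)} (h : PolyboxCode compl4 V) :
    Code (V.image encw) := by
  intro a ha b hb hm
  simp only [Finset.mem_image] at ha hb
  obtain ⟨u, hu, rfl⟩ := ha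
  obtain ⟨v, hv, rfl⟩ := hb
  by_contra hne
  obtain ⟨j, hj⟩ := h u hu v hv (fun e => hne (by rw [e]))
  have h1 : encw v j = ((encw u j).1, !(encw u j).2) := by
    simp only [encw]; rw [hj, enc_compl]
  have := hm j (by rw [h1])
  rw [h1] at this
  simp at this

lemma tf_enc {d : ℕ} {V : Finset (Fin d → Fin 4)} (h : TwinPairFree compl4 V) :
    TF (V.image encw) := by
  intro a ha b hb hm
  simp only [Finset.mem_image] at ha hb
  obtain ⟨u, hu, rfl⟩ := ha
  obtain ⟨v, hv, rfl⟩ := hb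
  obtain ⟨j, h1, h2, h3⟩ := hm
  exact h u hu v hv ⟨j, enc_opp _ _ h1 h2, fun i hi => enc_inj (h3 i hi)⟩

lemma mem_real {d : ℕ} (p : Pt (Fin d)) (V : Finset (Fin d → Fin 4)) :
    ptset p ∈ CodeReal compl4 V ↔ ∃ v ∈ V.image encw, In p v := by
  simp only [CodeReal, Set.mem_iUnion, mem_box, Finset.mem_image, exists_prop]
  constructor
  · rintro ⟨v, hv, h⟩; exact ⟨_, ⟨v, hv, rfl⟩, h⟩
  · rintro ⟨_, ⟨v, hv, rfl⟩, h⟩; exact ⟨v, hv, h⟩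

end PB

/-- Every polybox code `V ⊆ {a,a',b,b'}^d`, `d ∈ {4,5}`, without twin pairs and
with at most `10` words is rigid: every polybox code equivalent to `V` equals `V`. -/
theorem small_code_rigid (d : ℕ) (hd : d = 4 ∨ d = 5)
    (V : Finset (Fin d → Fin 4)) (hVcode : PolyboxCode compl4 V)
    (hVtp : TwinPairFree compl4 V) (hcard : V.card ≤ 10)
    (W : Finset (Fin d → Fin 4)) (hWcode : PolyboxCode compl4 W)
    (hequiv : EquivalentCodes compl4 V W) : W = V := by
  have h := PB.core _ (V.image PB.encw) (W.image PB.encw) rfl (Finset.card_image_le.trans hcard)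
    (PB.code_enc hVcode) (PB.code_enc hWcode) (PB.tf_enc hVtp) (by
      intro p
      rw [← PB.mem_real, ← PB.mem_real]
      unfold EquivalentCodes at hequiv
      rw [hequiv])
  exact (Finset.image_injective PB.encw_inj h).symm
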